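/- Let (f,g,ρ) be a warped Berger solution of Ricci flow on S^1×S^3 defined on [0,T) satisfying Assumption B. Then there exists a uniform constant C < ∞ such that |κ_{12}(ξ,t) − κ_{23}(ξ,t)| ≤ C/M(ξ,t) for all (ξ,t) ∈ S^1×[0,T); consequently the scale-invariant quantity (T−t)|κ_{12} − κ_{23}| satisfies (T−t)|κ_{12}(ξ,t) − κ_{23}(ξ,t)| ≤ C·√(T−t) on S^1×[0,T). -/

import Mathlib

open Real Set Filter Topology

noncomputable section

/-- Partial derivative in the first (spatial, `ξ`) variable. -/
def pd1 (φ : ℝ → ℝ → ℝ) (ξ t : ℝ) : ℝ := deriv (fun x => φ x t) ξ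

/-- Partial derivative in the second (time) variable: `φ_t`. -/
def pdt (φ : ℝ → ℝ → ℝ) (ξ t : ℝ) : ℝ := deriv (fun τ => φ ξ τ) t

/-- Derivative with respect to arclength `s` (where `ds = ρ dξ`): `φ_s := ρ⁻¹ ∂_ξ φ`. -/
def Ds (ρ φ : ℝ → ℝ → ℝ) (ξ t : ℝ) : ℝ := pd1 φ ξ t / ρ ξ t

/-- Sectional curvature `κ₁₂ = κ₃₁ = f²/g⁴ − f_s g_s/(f g)`. -/
def k12 (ρ f g : ℝ → ℝ → ℝ) (ξ t : ℝ) : ℝ :=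
  (f ξ t) ^ 2 / (g ξ t) ^ 4 - Ds ρ f ξ t * Ds ρ g ξ t / (f ξ t * g ξ t)

/-- Sectional curvature `κ₃₁ = κ₁₂`. -/
def k31 (ρ f g : ℝ → ℝ → ℝ) (ξ t : ℝ) : ℝ :=
  (f ξ t) ^ 2 / (g ξ t) ^ 4 - Ds ρ f ξ t * Ds ρ g ξ t / (f ξ t * g ξ t)

/-- Sectional curvature `κ₂₃ = (4g² − 3f²)/g⁴ − g_s²/g²`. -/
def k23 (ρ f g : ℝ → ℝ → ℝ) (ξ t : ℝ) : ℝ :=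
  (4 * (g ξ t) ^ 2 - 3 * (f ξ t) ^ 2) / (g ξ t) ^ 4 - (Ds ρ g ξ t) ^ 2 / (g ξ t) ^ 2

/-- Sectional curvature `κ₀₁ = −f_ss/f`. -/
def k01 (ρ f : ℝ → ℝ → ℝ) (ξ t : ℝ) : ℝ := -(Ds ρ (Ds ρ f) ξ t) / f ξ t

/-- Sectional curvature `κ₀₂ = κ₀₃ = −g_ss/g`. -/
def k02 (ρ g : ℝ → ℝ → ℝ) (ξ t : ℝ) : ℝ := -(Ds ρ (Ds ρ g) ξ t) / g ξ t

/-- Scalar curvature `R = κ₀₁ + 2κ₀₂ + 2κ₁₂ + κ₂₃`. -/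
def scalR (ρ f g : ℝ → ℝ → ℝ) (ξ t : ℝ) : ℝ :=
  k01 ρ f ξ t + 2 * k02 ρ g ξ t + 2 * k12 ρ f g ξ t + k23 ρ f g ξ t

/-- `M(ξ,t) := min {f(ξ,t), g(ξ,t)}`. -/
def M (f g : ℝ → ℝ → ℝ) (ξ t : ℝ) : ℝ := min (f ξ t) (g ξ t)

/-- `M̌(t) := min_{ξ ∈ S¹} M(ξ,t)`. -/
def Mcheck (f g : ℝ → ℝ → ℝ) (t : ℝ) : ℝ := ⨅ ξ : ℝ, M f g ξ t

/-- A warped Berger solution of Ricci flow on `S¹ × S³` with (finite) existence time `T`: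
smooth positive `2π`-periodic-in-`ξ` functions `f, g, ρ` on `S¹ × [0,T)` satisfying
  `f_t = f_ss + 2 (g_s/g) f_s − 2 f³/g⁴`,
  `g_t = g_ss + (f_s/f + g_s/g) g_s + 2 (f² − 2g²)/g³`,
  `(log ρ)_t = f_ss/f + 2 g_ss/g`. -/
structure WarpedBerger (T : ℝ) (f g ρ : ℝ → ℝ → ℝ) : Prop where
  T_pos : 0 < T
  f_pos : ∀ ξ t : ℝ, 0 ≤ t → t < T → 0 < f ξ t
  g_pos : ∀ ξ t : ℝ, 0 ≤ t → t < T → 0 < g ξ t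
  ρ_pos : ∀ ξ t : ℝ, 0 ≤ t → t < T → 0 < ρ ξ t
  f_per : ∀ ξ t : ℝ, f (ξ + 2 * π) t = f ξ t
  g_per : ∀ ξ t : ℝ, g (ξ + 2 * π) t = g ξ t
  ρ_per : ∀ ξ t : ℝ, ρ (ξ + 2 * π) t = ρ ξ t
  smooth : ContDiffOn ℝ (⊤ : ℕ∞)
      (fun p : ℝ × ℝ => (f p.1 p.2, g p.1 p.2, ρ p.1 p.2)) (Set.univ ×ˢ Set.Ico 0 T)
  eq_f : ∀ ξ t : ℝ, 0 < t → t < T →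
    pdt f ξ t = Ds ρ (Ds ρ f) ξ t + 2 * (Ds ρ g ξ t / g ξ t) * Ds ρ f ξ t
      - 2 * (f ξ t) ^ 3 / (g ξ t) ^ 4
  eq_g : ∀ ξ t : ℝ, 0 < t → t < T →
    pdt g ξ t = Ds ρ (Ds ρ g) ξ t
      + (Ds ρ f ξ t / f ξ t + Ds ρ g ξ t / g ξ t) * Ds ρ g ξ t
      + 2 * ((f ξ t) ^ 2 - 2 * (g ξ t) ^ 2) / (g ξ t) ^ 3
  eq_ρ : ∀ ξ t : ℝ, 0 < t → t < T →
    pdt (fun x τ => Real.log (ρ x τ)) ξ t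
      = Ds ρ (Ds ρ f) ξ t / f ξ t + 2 * (Ds ρ (Ds ρ g) ξ t / g ξ t)

/-- The Ricci curvature blows up as `t ↗ T`:
`limsup_{t↗T} max_ξ (|κ₀₁+2κ₁₂| + |κ₀₁+2κ₀₂| + |κ₀₂+κ₁₂+κ₂₃|) = ∞`, where the three
displayed quantities are the diagonal components of the Ricci tensor. -/
def RicciBlowup (T : ℝ) (f g ρ : ℝ → ℝ → ℝ) : Prop :=
  ∀ K : ℝ, ∀ t₀ : ℝ, 0 ≤ t₀ → t₀ < T → ∃ ξ t : ℝ, t₀ < t ∧ t < T ∧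
    K < |k01 ρ f ξ t + 2 * k12 ρ f g ξ t| + |k01 ρ f ξ t + 2 * k02 ρ g ξ t|
        + |k02 ρ g ξ t + k12 ρ f g ξ t + k23 ρ f g ξ t|

/-- Assumption A: `f ≤ g` at `t = 0`; `(min_ξ R(ξ,0))·(max_ξ g(ξ,0)²) > −3`;
and the Ricci curvature blows up at the finite time `T`. -/
structure AssumptionA (T : ℝ) (f g ρ : ℝ → ℝ → ℝ) extends WarpedBerger T f g ρ : Prop where
  init_order : ∀ ξ : ℝ, f ξ 0 ≤ g ξ 0
  init_scalar : (⨅ ξ : ℝ, scalR ρ f g ξ 0) * (⨆ ξ : ℝ, (g ξ 0) ^ 2) > -3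
  ricci_blowup : RicciBlowup T f g ρ

/-- Assumption B: Assumption A and, in addition, at `t = 0` one has `f ≥ (1−ε)g` for some
`ε ∈ (0,1)` with `2(1−ε)⁵ + 4(1−ε)⁴ > 4/3`, and `|f_s| ≤ 1` at `t = 0`. -/
structure AssumptionB (T : ℝ) (f g ρ : ℝ → ℝ → ℝ) extends AssumptionA T f g ρ : Prop where
  init_pinched : ∃ ε : ℝ, 0 < ε ∧ ε < 1 ∧ 2 * (1 - ε) ^ 5 + 4 * (1 - ε) ^ 4 > 4 / 3 ∧
    ∀ ξ : ℝ, (1 - ε) * g ξ 0 ≤ f ξ 0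
  init_fs : ∀ ξ : ℝ, |Ds ρ f ξ 0| ≤ 1

/-- Smoothness on `ℝ × [0,T)`. -/
def Sm (T : ℝ) (φ : ℝ → ℝ → ℝ) : Prop :=
  ContDiffOn ℝ (⊤ : ℕ∞) (fun p : ℝ × ℝ => φ p.1 p.2) (Set.univ ×ˢ Set.Ico 0 T)

lemma uniqueS (T : ℝ) : UniqueDiffOn ℝ ((Set.univ : Set ℝ) ×ˢ Set.Ico (0:ℝ) T) :=
  uniqueDiffOn_univ.prod (uniqueDiffOn_Ico 0 T)

lemma Sm.pd1_eq {T : ℝ} {φ : ℝ → ℝ → ℝ} (h : Sm T φ) {ξ t : ℝ} (h0 : 0 ≤ t) (hT : t < T) :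
    HasDerivAt (fun x => φ x t) (fderivWithin ℝ (fun p : ℝ × ℝ => φ p.1 p.2)
      (Set.univ ×ˢ Set.Ico 0 T) (ξ, t) (1, 0)) ξ := by
  have hd := ((ContDiffOn.differentiableOn h (by simp)) (ξ, t) ⟨mem_univ _, h0, hT⟩).hasFDerivWithinAt
  have hc : HasDerivWithinAt (fun x : ℝ => (x, t)) ((1:ℝ), (0:ℝ)) univ ξ :=
    ((hasDerivAt_id ξ).prodMk (hasDerivAt_const ξ t)).hasDerivWithinAt
  have := HasFDerivWithinAt.comp_hasDerivWithinAt (f := fun x : ℝ => (x, t)) ξ hd hc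
    (fun x _ => ⟨mem_univ _, h0, hT⟩)
  exact hasDerivWithinAt_univ.1 this

lemma Sm.hs {T : ℝ} {φ : ℝ → ℝ → ℝ} (h : Sm T φ) {ξ t : ℝ} (h0 : 0 ≤ t) (hT : t < T) :
    HasDerivAt (fun x => φ x t) (pd1 φ ξ t) ξ :=
  (h.pd1_eq h0 hT).differentiableAt.hasDerivAt

lemma Sm.at {T : ℝ} {φ : ℝ → ℝ → ℝ} (h : Sm T φ) {ξ t : ℝ} (h0 : 0 < t) (hT : t < T) :
    ContDiffAt ℝ (⊤ : ℕ∞) (fun p : ℝ × ℝ => φ p.1 p.2) (ξ, t) := by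
  refine ContDiffOn.contDiffAt h ?_
  exact prod_mem_nhds univ_mem (Ico_mem_nhds h0 hT)

lemma Sm.ht' {T : ℝ} {φ : ℝ → ℝ → ℝ} (h : Sm T φ) {ξ t : ℝ} (h0 : 0 < t) (hT : t < T) :
    HasDerivAt (fun τ => φ ξ τ) (fderiv ℝ (fun p : ℝ × ℝ => φ p.1 p.2) (ξ, t) (0, 1)) t := by
  have hd := ((h.at (ξ := ξ) h0 hT).differentiableAt (by simp)).hasFDerivAt
  have hc : HasDerivAt (fun x : ℝ => (ξ, x)) ((0:ℝ), (1:ℝ)) t :=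
    (hasDerivAt_const t ξ).prodMk (hasDerivAt_id t)
  exact HasFDerivAt.comp_hasDerivAt (f := fun x : ℝ => (ξ, x)) t hd hc

lemma Sm.hs' {T : ℝ} {φ : ℝ → ℝ → ℝ} (h : Sm T φ) {ξ t : ℝ} (h0 : 0 < t) (hT : t < T) :
    HasDerivAt (fun x => φ x t) (fderiv ℝ (fun p : ℝ × ℝ => φ p.1 p.2) (ξ, t) (1, 0)) ξ := by
  have hd := ((h.at (ξ := ξ) h0 hT).differentiableAt (by simp)).hasFDerivAt
  have hc : HasDerivAt (fun x : ℝ => (x, t)) ((1:ℝ), (0:ℝ)) ξ :=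
    (hasDerivAt_id ξ).prodMk (hasDerivAt_const ξ t)
  exact HasFDerivAt.comp_hasDerivAt (f := fun x : ℝ => (x, t)) ξ hd hc

lemma Sm.ht {T : ℝ} {φ : ℝ → ℝ → ℝ} (h : Sm T φ) {ξ t : ℝ} (h0 : 0 < t) (hT : t < T) :
    HasDerivAt (fun τ => φ ξ τ) (pdt φ ξ t) t :=
  (h.ht' h0 hT).differentiableAt.hasDerivAt

lemma Sm.pd1 {T : ℝ} {φ : ℝ → ℝ → ℝ} (h : Sm T φ) : Sm T (pd1 φ) := by
  have h1 : ContDiffOn ℝ (⊤ : ℕ∞) (fun p : ℝ × ℝ => fderivWithin ℝ (fun p : ℝ × ℝ => φ p.1 p.2)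
      (Set.univ ×ˢ Set.Ico 0 T) p (1, 0)) (Set.univ ×ˢ Set.Ico 0 T) :=
    (ContDiffOn.fderivWithin h (uniqueS T) (by simp)).clm_apply contDiffOn_const
  refine h1.congr ?_
  rintro ⟨x, t⟩ ⟨-, h0, hT⟩
  exact (h.pd1_eq h0 hT).deriv

lemma Sm.comm {T : ℝ} {φ : ℝ → ℝ → ℝ} (h : Sm T φ) {ξ t : ℝ} (h0 : 0 < t) (hT : t < T) :
    HasDerivAt (fun x => pdt φ x t) (pdt (_root_.pd1 φ) ξ t) ξ := by
  set F : ℝ × ℝ → ℝ := fun p => φ p.1 p.2 with hF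
  have hc := h.at (ξ := ξ) h0 hT
  have hsym : IsSymmSndFDerivAt ℝ F (ξ, t) := hc.isSymmSndFDerivAt (by simp; norm_cast)
  have hd : HasFDerivAt (fderiv ℝ F) (fderiv ℝ (fderiv ℝ F) (ξ, t)) (ξ, t) :=
    ((hc.fderiv_right (m := 1) (by norm_cast)).differentiableAt (by simp)).hasFDerivAt
  have c1 : HasDerivAt (fun x : ℝ => (x, t)) ((1:ℝ), (0:ℝ)) ξ :=
    (hasDerivAt_id ξ).prodMk (hasDerivAt_const ξ t)
  have c2 : HasDerivAt (fun x : ℝ => (ξ, x)) ((0:ℝ), (1:ℝ)) t :=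
    (hasDerivAt_const t ξ).prodMk (hasDerivAt_id t)
  have e1 := HasFDerivAt.comp_hasDerivAt (f := fun x : ℝ => (x, t)) ξ hd c1
  have e2 := HasFDerivAt.comp_hasDerivAt (f := fun x : ℝ => (ξ, x)) t hd c2
  have e1' := e1.clm_apply (hasDerivAt_const ξ ((0:ℝ), (1:ℝ)))
  have e2' := e2.clm_apply (hasDerivAt_const t ((1:ℝ), (0:ℝ)))
  simp only [Function.comp_apply, map_zero, add_zero] at e1' e2'
  have k1 : (fun x => pdt φ x t) = fun x => fderiv ℝ F (x, t) (0, 1) := by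
    funext x; exact (h.ht' h0 hT).deriv
  have k2 : (fun τ => _root_.pd1 φ ξ τ) =ᶠ[𝓝 t] fun τ => fderiv ℝ F (ξ, τ) (1, 0) := by
    filter_upwards [Ioo_mem_nhds h0 hT] with τ hτ
    exact (h.hs' hτ.1 hτ.2).deriv
  have k3 : pdt (_root_.pd1 φ) ξ t = fderiv ℝ (fderiv ℝ F) (ξ, t) (0, 1) (1, 0) := by
    unfold pdt
    rw [k2.deriv_eq]
    exact e2'.deriv
  rw [k1, k3, hsym]
  exact e1'

lemma Sm.add {T : ℝ} {φ ψ : ℝ → ℝ → ℝ} (h : Sm T φ) (k : Sm T ψ) : Sm T (φ + ψ) :=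
  ContDiffOn.add h k
lemma Sm.sub {T : ℝ} {φ ψ : ℝ → ℝ → ℝ} (h : Sm T φ) (k : Sm T ψ) : Sm T (φ - ψ) :=
  ContDiffOn.sub h k
lemma Sm.mul {T : ℝ} {φ ψ : ℝ → ℝ → ℝ} (h : Sm T φ) (k : Sm T ψ) : Sm T (φ * ψ) :=
  ContDiffOn.mul h k
lemma Sm.smul {T : ℝ} {φ : ℝ → ℝ → ℝ} (r : ℝ) (h : Sm T φ) : Sm T (r • φ) :=
  ContDiffOn.const_smul r h

/-- Pointwise exponential. -/
def eX (φ : ℝ → ℝ → ℝ) : ℝ → ℝ → ℝ := fun x t => Real.exp (φ x t)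

lemma Sm.eX {T : ℝ} {φ : ℝ → ℝ → ℝ} (h : Sm T φ) : Sm T (eX φ) :=
  ContDiffOn.exp h

lemma Sm.log {T : ℝ} {φ : ℝ → ℝ → ℝ} (h : Sm T φ)
    (hp : ∀ ξ t : ℝ, 0 ≤ t → t < T → 0 < φ ξ t) : Sm T (fun x t => Real.log (φ x t)) :=
  ContDiffOn.log h (fun p hp' => (hp p.1 p.2 hp'.2.1 hp'.2.2).ne')

/-- Background data: metric factor `ρ`, drift `n`, and `c` with `(log ρ)_t = n_s + c`. -/
structure Bg (T : ℝ) (ρ n c : ℝ → ℝ → ℝ) : Prop where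
  ρsm : Sm T ρ
  ρpos : ∀ ξ t : ℝ, 0 ≤ t → t < T → 0 < ρ ξ t
  ρper : ∀ ξ t : ℝ, ρ (ξ + 2 * π) t = ρ ξ t
  nsm : Sm T n
  ρt : ∀ ξ t : ℝ, 0 < t → t < T → pdt ρ ξ t = ρ ξ t * (Ds ρ n ξ t + c ξ t)

section rules
variable {T : ℝ} {ρ n c : ℝ → ℝ → ℝ}

lemma Sm.Ds {φ : ℝ → ℝ → ℝ} (h : Sm T φ) (b : Bg T ρ n c) : Sm T (Ds ρ φ) :=
  ContDiffOn.div h.pd1 b.ρsm (fun p hp => (b.ρpos p.1 p.2 hp.2.1 hp.2.2).ne')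

lemma Ds_add {φ ψ : ℝ → ℝ → ℝ} (h : Sm T φ) (k : Sm T ψ) {ξ t : ℝ} (h0 : 0 ≤ t) (hT : t < T) :
    Ds ρ (φ + ψ) ξ t = Ds ρ φ ξ t + Ds ρ ψ ξ t := by
  have : pd1 (φ + ψ) ξ t = _ := ((h.hs h0 hT).add (k.hs h0 hT)).deriv
  simp only [Ds, this]; ring
lemma Ds_sub {φ ψ : ℝ → ℝ → ℝ} (h : Sm T φ) (k : Sm T ψ) {ξ t : ℝ} (h0 : 0 ≤ t) (hT : t < T) :
    Ds ρ (φ - ψ) ξ t = Ds ρ φ ξ t - Ds ρ ψ ξ t := by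
  have : pd1 (φ - ψ) ξ t = _ := ((h.hs h0 hT).sub (k.hs h0 hT)).deriv
  simp only [Ds, this]; ring
lemma Ds_mul {φ ψ : ℝ → ℝ → ℝ} (h : Sm T φ) (k : Sm T ψ) {ξ t : ℝ} (h0 : 0 ≤ t) (hT : t < T) :
    Ds ρ (φ * ψ) ξ t = φ ξ t * Ds ρ ψ ξ t + ψ ξ t * Ds ρ φ ξ t := by
  have : pd1 (φ * ψ) ξ t = _ := ((h.hs h0 hT).mul (k.hs h0 hT)).deriv
  simp only [Ds, this]; ring
lemma Ds_smul {φ : ℝ → ℝ → ℝ} (r : ℝ) (h : Sm T φ) {ξ t : ℝ} (h0 : 0 ≤ t) (hT : t < T) :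
    Ds ρ (r • φ) ξ t = r * Ds ρ φ ξ t := by
  have : pd1 (r • φ) ξ t = _ := ((h.hs h0 hT).const_mul r).deriv
  simp only [Ds, this]; ring
lemma Ds_eX {φ : ℝ → ℝ → ℝ} (h : Sm T φ) {ξ t : ℝ} (h0 : 0 ≤ t) (hT : t < T) :
    Ds ρ (eX φ) ξ t = eX φ ξ t * Ds ρ φ ξ t := by
  have : pd1 (eX φ) ξ t = _ := ((h.hs h0 hT).exp).deriv
  simp only [Ds, this, eX]; ring

lemma Ds_congr {φ ψ : ℝ → ℝ → ℝ} {t : ℝ} (h : ∀ x, φ x t = ψ x t) (ξ : ℝ) :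
    Ds ρ φ ξ t = Ds ρ ψ ξ t := by
  have : (fun x => φ x t) = fun x => ψ x t := funext h
  simp only [Ds, pd1, this]

lemma pdt_add {φ ψ : ℝ → ℝ → ℝ} (h : Sm T φ) (k : Sm T ψ) {ξ t : ℝ} (h0 : 0 < t) (hT : t < T) :
    pdt (φ + ψ) ξ t = pdt φ ξ t + pdt ψ ξ t := ((h.ht h0 hT).add (k.ht h0 hT)).deriv
lemma pdt_sub {φ ψ : ℝ → ℝ → ℝ} (h : Sm T φ) (k : Sm T ψ) {ξ t : ℝ} (h0 : 0 < t) (hT : t < T) :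
    pdt (φ - ψ) ξ t = pdt φ ξ t - pdt ψ ξ t := ((h.ht h0 hT).sub (k.ht h0 hT)).deriv
lemma pdt_mul {φ ψ : ℝ → ℝ → ℝ} (h : Sm T φ) (k : Sm T ψ) {ξ t : ℝ} (h0 : 0 < t) (hT : t < T) :
    pdt (φ * ψ) ξ t = pdt φ ξ t * ψ ξ t + φ ξ t * pdt ψ ξ t :=
  ((h.ht h0 hT).mul (k.ht h0 hT)).deriv
lemma pdt_smul {φ : ℝ → ℝ → ℝ} (r : ℝ) (h : Sm T φ) {ξ t : ℝ} (h0 : 0 < t) (hT : t < T) :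
    pdt (r • φ) ξ t = r * pdt φ ξ t := ((h.ht h0 hT).const_mul r).deriv
lemma pdt_eX {φ : ℝ → ℝ → ℝ} (h : Sm T φ) {ξ t : ℝ} (h0 : 0 < t) (hT : t < T) :
    pdt (eX φ) ξ t = eX φ ξ t * pdt φ ξ t := ((h.ht h0 hT).exp).deriv

lemma Ds_per {φ : ℝ → ℝ → ℝ} (b : Bg T ρ n c) (h : ∀ ξ t : ℝ, φ (ξ + 2 * π) t = φ ξ t)
    (ξ t : ℝ) : Ds ρ φ (ξ + 2 * π) t = Ds ρ φ ξ t := by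
  unfold Ds pd1
  rw [b.ρper, ← deriv_comp_add_const]
  simp only [h]

/-- `φ` solves the heat equation `φ_t = φ_ss + n φ_s + Φ`. -/
structure Heat (T : ℝ) (ρ n φ Φ : ℝ → ℝ → ℝ) : Prop where
  sm : Sm T φ
  per : ∀ ξ t : ℝ, φ (ξ + 2 * π) t = φ ξ t
  eq : ∀ ξ t : ℝ, 0 < t → t < T →
    pdt φ ξ t = Ds ρ (Ds ρ φ) ξ t + n ξ t * Ds ρ φ ξ t + Φ ξ t

lemma Heat.add {φ ψ Φ Ψ : ℝ → ℝ → ℝ} (b : Bg T ρ n c) (h : Heat T ρ n φ Φ) (k : Heat T ρ n ψ Ψ) :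
    Heat T ρ n (φ + ψ) (Φ + Ψ) where
  sm := h.sm.add k.sm
  per ξ t := by simp [h.per, k.per]
  eq ξ t h0 hT := by
    rw [pdt_add h.sm k.sm h0 hT, h.eq ξ t h0 hT, k.eq ξ t h0 hT,
      Ds_add h.sm k.sm h0.le hT,
      Ds_congr (ψ := Ds ρ φ + Ds ρ ψ) (fun x => Ds_add h.sm k.sm h0.le hT),
      Ds_add (h.sm.Ds b) (k.sm.Ds b) h0.le hT]
    simp only [Pi.add_apply]; ring

lemma Heat.sub {φ ψ Φ Ψ : ℝ → ℝ → ℝ} (b : Bg T ρ n c) (h : Heat T ρ n φ Φ) (k : Heat T ρ n ψ Ψ) :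
    Heat T ρ n (φ - ψ) (Φ - Ψ) where
  sm := h.sm.sub k.sm
  per ξ t := by simp [h.per, k.per]
  eq ξ t h0 hT := by
    rw [pdt_sub h.sm k.sm h0 hT, h.eq ξ t h0 hT, k.eq ξ t h0 hT,
      Ds_sub h.sm k.sm h0.le hT,
      Ds_congr (ψ := Ds ρ φ - Ds ρ ψ) (fun x => Ds_sub h.sm k.sm h0.le hT),
      Ds_sub (h.sm.Ds b) (k.sm.Ds b) h0.le hT]
    simp only [Pi.sub_apply]; ring

lemma Heat.smul {φ Φ : ℝ → ℝ → ℝ} (b : Bg T ρ n c) (r : ℝ) (h : Heat T ρ n φ Φ) :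
    Heat T ρ n (r • φ) (r • Φ) where
  sm := h.sm.smul r
  per ξ t := by simp [h.per]
  eq ξ t h0 hT := by
    rw [pdt_smul r h.sm h0 hT, h.eq ξ t h0 hT,
      Ds_smul r h.sm h0.le hT,
      Ds_congr (ψ := r • Ds ρ φ) (fun x => Ds_smul r h.sm h0.le hT),
      Ds_smul r (h.sm.Ds b) h0.le hT]
    simp only [Pi.smul_apply, smul_eq_mul]; ring

lemma Heat.mul {φ ψ Φ Ψ : ℝ → ℝ → ℝ} (b : Bg T ρ n c) (h : Heat T ρ n φ Φ) (k : Heat T ρ n ψ Ψ) :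
    Heat T ρ n (φ * ψ) (φ * Ψ + ψ * Φ - (2:ℝ) • (Ds ρ φ * Ds ρ ψ)) where
  sm := h.sm.mul k.sm
  per ξ t := by simp [h.per, k.per]
  eq ξ t h0 hT := by
    rw [pdt_mul h.sm k.sm h0 hT, h.eq ξ t h0 hT, k.eq ξ t h0 hT,
      Ds_mul h.sm k.sm h0.le hT,
      Ds_congr (ψ := φ * Ds ρ ψ + ψ * Ds ρ φ) (fun x => Ds_mul h.sm k.sm h0.le hT),
      Ds_add (h.sm.mul (k.sm.Ds b)) (k.sm.mul (h.sm.Ds b)) h0.le hT,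
      Ds_mul h.sm (k.sm.Ds b) h0.le hT, Ds_mul k.sm (h.sm.Ds b) h0.le hT]
    simp only [Pi.add_apply, Pi.sub_apply, Pi.mul_apply, Pi.smul_apply, smul_eq_mul]; ring

lemma Heat.eX {φ Φ : ℝ → ℝ → ℝ} (b : Bg T ρ n c) (h : Heat T ρ n φ Φ) :
    Heat T ρ n (eX φ) (eX φ * (Φ - Ds ρ φ * Ds ρ φ)) where
  sm := h.sm.eX
  per ξ t := by simp [_root_.eX, h.per]
  eq ξ t h0 hT := by
    rw [pdt_eX h.sm h0 hT, h.eq ξ t h0 hT,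
      Ds_eX h.sm h0.le hT,
      Ds_congr (ψ := _root_.eX φ * Ds ρ φ) (fun x => Ds_eX h.sm h0.le hT),
      Ds_mul h.sm.eX (h.sm.Ds b) h0.le hT, Ds_eX h.sm h0.le hT]
    simp only [Pi.sub_apply, Pi.mul_apply]; ring

lemma Heat.Ds {φ Φ : ℝ → ℝ → ℝ} (b : Bg T ρ n c) (h : Heat T ρ n φ Φ) (hΦ : Sm T Φ) :
    Heat T ρ n (Ds ρ φ) (Ds ρ Φ - c * Ds ρ φ) where
  sm := h.sm.Ds b
  per ξ t := Ds_per b h.per ξ t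
  eq ξ t h0 hT := by
    have hp := b.ρpos ξ t h0.le hT
    have e1 : pdt (_root_.Ds ρ φ) ξ t = _ :=
      ((h.sm.pd1.ht h0 hT).div (b.ρsm.ht h0 hT) hp.ne').deriv
    have e2 := (h.sm.comm (ξ := ξ) h0 hT).deriv
    have e3 : deriv (fun x => pdt φ x t) ξ = ρ ξ t *
        _root_.Ds ρ (_root_.Ds ρ (_root_.Ds ρ φ) + n * _root_.Ds ρ φ + Φ) ξ t := by
      rw [show (fun x => pdt φ x t) = fun x =>
        (_root_.Ds ρ (_root_.Ds ρ φ) + n * _root_.Ds ρ φ + Φ) x t from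
          funext fun x => h.eq x t h0 hT]
      simp only [_root_.Ds, pd1]; field_simp
    rw [Ds_add (((h.sm.Ds b).Ds b).add (b.nsm.mul (h.sm.Ds b))) hΦ h0.le hT,
      Ds_add ((h.sm.Ds b).Ds b) (b.nsm.mul (h.sm.Ds b)) h0.le hT,
      Ds_mul b.nsm (h.sm.Ds b) h0.le hT] at e3
    rw [e1, ← e2, e3, b.ρt ξ t h0 hT]
    have e4 : pd1 φ ξ t = ρ ξ t * _root_.Ds ρ φ ξ t := by simp only [_root_.Ds]; field_simp
    rw [e4]
    simp only [Pi.sub_apply, Pi.mul_apply]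
    field_simp
    ring

lemma Sm.cont {φ : ℝ → ℝ → ℝ} (h : Sm T φ) :
    ContinuousOn (fun p : ℝ × ℝ => φ p.1 p.2) (Set.univ ×ˢ Set.Ico 0 T) := ContDiffOn.continuousOn h

lemma second_deriv_max {v : ℝ → ℝ} {x : ℝ} (hc : ContinuousAt v x) (hm : ∀ y, v y ≤ v x) :
    deriv v x = 0 ∧ deriv (deriv v) x ≤ 0 := by
  have hmax : IsLocalMax v x := Filter.Eventually.of_forall hm
  refine ⟨hmax.deriv_eq_zero, ?_⟩
  by_contra hneg
  push Not at hneg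
  have hmin := isLocalMin_of_deriv_deriv_pos hneg hmax.deriv_eq_zero hc
  have he : v =ᶠ[𝓝 x] fun _ => v x := by
    filter_upwards [hmin] with y hy
    exact le_antisymm (hm y) hy
  have h2 : deriv v =ᶠ[𝓝 x] fun _ => 0 := by
    have := he.deriv
    simpa using this
  have := h2.deriv_eq
  simp at this
  linarith

lemma crit_of_max {u : ℝ → ℝ → ℝ} (b : Bg T ρ n c) (h : Sm T u) {ξ t : ℝ} (h0 : 0 ≤ t) (hT : t < T)
    (hm : ∀ y, u y t ≤ u ξ t) : Ds ρ u ξ t = 0 ∧ Ds ρ (Ds ρ u) ξ t ≤ 0 := by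
  obtain ⟨h1, h2⟩ := second_deriv_max (h.hs (ξ := ξ) h0 hT).continuousAt hm
  have hp := b.ρpos ξ t h0 hT
  have h1' : pd1 u ξ t = 0 := h1
  refine ⟨by simp [Ds, h1'], ?_⟩
  have e : pd1 (Ds ρ u) ξ t = _ := ((h.pd1.hs h0 hT).div (b.ρsm.hs h0 hT) hp.ne').deriv
  have h2' : pd1 (pd1 u) ξ t ≤ 0 := h2
  rw [Ds, e, h1']
  have : (pd1 (pd1 u) ξ t * ρ ξ t - 0 * pd1 ρ ξ t) / ρ ξ t ^ 2 / ρ ξ t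
      = pd1 (pd1 u) ξ t / ρ ξ t ^ 2 := by field_simp; ring
  rw [this]
  exact div_nonpos_of_nonpos_of_nonneg h2' (by positivity)

lemma max_principle {u U : ℝ → ℝ → ℝ} (b : Bg T ρ n c) (h : Heat T ρ n u U) (K : ℝ)
    (hi : ∀ ξ, u ξ 0 ≤ K)
    (hU : ∀ ξ t, 0 < t → t < T → K < u ξ t → Ds ρ u ξ t = 0 → U ξ t ≤ 0) :
    ∀ ξ t, 0 ≤ t → t < T → u ξ t ≤ K := by
  intro ξ₁ t₁ h0 hT
  by_contra hcon
  push Not at hcon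
  have ht1 : 0 < t₁ := by
    rcases h0.eq_or_lt with h' | h'
    · subst h'; exact absurd (hi ξ₁) (not_le.2 hcon)
    · exact h'
  set η := (u ξ₁ t₁ - K) / (2 * t₁) with hη
  have hηp : 0 < η := by apply div_pos <;> linarith
  have hηe : η * t₁ = (u ξ₁ t₁ - K) / 2 := by rw [hη]; field_simp
  have hper : ∀ t, Function.Periodic (fun x => u x t) (2 * π) := fun t x => h.per x t
  have hcomp : IsCompact (Icc (0:ℝ) (2 * π) ×ˢ Icc (0:ℝ) t₁) := isCompact_Icc.prod isCompact_Icc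
  have hcont : ContinuousOn (fun p : ℝ × ℝ => u p.1 p.2 - η * p.2)
      (Icc (0:ℝ) (2 * π) ×ˢ Icc (0:ℝ) t₁) := by
    refine ContinuousOn.sub (h.sm.cont.mono ?_) (by fun_prop)
    rintro ⟨x, t⟩ ⟨-, hx⟩
    exact ⟨mem_univ _, hx.1, lt_of_le_of_lt hx.2 hT⟩
  have hne : (Icc (0:ℝ) (2 * π) ×ˢ Icc (0:ℝ) t₁).Nonempty :=
    ⟨(0, 0), ⟨le_rfl, by positivity⟩, le_rfl, ht1.le⟩
  obtain ⟨⟨ξ, t⟩, ⟨hξ, ht⟩, hmax⟩ := hcomp.exists_isMaxOn hne hcont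
  have hmax' : ∀ x τ, 0 ≤ τ → τ ≤ t₁ → u x τ - η * τ ≤ u ξ t - η * t := by
    intro x τ hτ0 hτ1
    obtain ⟨y, hy, hxy⟩ := (hper τ).exists_mem_Ico₀ (by positivity) x
    have := hmax (show (y, τ) ∈ _ from ⟨⟨hy.1, hy.2.le⟩, hτ0, hτ1⟩)
    simp only [mem_ofPred_eq] at this
    have hxy' : u x τ = u y τ := hxy
    rw [hxy']; exact this
  simp only at hξ ht
  have hgt : K < u ξ t - η * t := by
    have := hmax' ξ₁ t₁ h0 le_rfl
    linarith
  have htT : t < T := lt_of_le_of_lt ht.2 hT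
  have htp : 0 < t := by
    rcases ht.1.eq_or_lt with h' | h'
    · rw [← h'] at hgt
      have := hi ξ
      linarith
    · exact h'
  have hKu : K < u ξ t := by nlinarith
  obtain ⟨c1, c2⟩ := crit_of_max b h.sm htp.le htT (fun y => by
    have := hmax' y t htp.le ht.2
    linarith : ∀ y, u y t ≤ u ξ t)
  have hUle := hU ξ t htp htT hKu c1
  have heq := h.eq ξ t htp htT
  rw [c1] at heq
  have hder := h.sm.ht (ξ := ξ) htp htT
  have hder2 : HasDerivAt (fun τ => u ξ τ - η * τ) (pdt u ξ t - η) t := by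
    have := hder.sub ((hasDerivAt_id t).const_mul η)
    rw [mul_one] at this; exact this
  have hge : 0 ≤ pdt u ξ t - η := by
    have hs := (hasDerivAt_iff_tendsto_slope_left_right.1 hder2).1
    refine ge_of_tendsto hs ?_
    filter_upwards [Ioo_mem_nhdsLT htp] with τ hτ
    rw [slope_def_field]
    apply div_nonneg_of_nonpos
    · have := hmax' ξ τ hτ.1.le (hτ.2.le.trans ht.2)
      linarith
    · linarith [hτ.2]
  linarith

lemma min_rate {E : ℝ → ℝ → ℝ} (hE : Sm T E) (hper : ∀ ξ t : ℝ, E (ξ + 2 * π) t = E ξ t)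
    (hpos : ∀ ξ t, 0 ≤ t → t < T → 0 < E ξ t) (κ : ℝ) 
    (hr : ∀ ξ t, 0 < t → t < T → (∀ y, E ξ t ≤ E y t) → pdt E ξ t ≤ -κ) :
    ∀ ξ t, 0 < t → t < T → κ * (T - t) ≤ E ξ t := by
  intro ξ₀ t₀ h0 hT
  by_contra hcon
  push Not at hcon
  have hlim : Tendsto (fun e : ℝ => (κ - e) * (T - e - t₀)) (𝓝[>] 0) (𝓝 (κ * (T - t₀))) := by
    have : ContinuousAt (fun e : ℝ => (κ - e) * (T - e - t₀)) 0 := by fun_prop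
    have h2 := this.tendsto
    simp only [sub_zero] at h2
    exact h2.mono_left nhdsWithin_le_nhds
  obtain ⟨e, ⟨he1, he2⟩⟩ := ((hlim.eventually (lt_mem_nhds hcon)).and
    (Ioo_mem_nhdsGT (show (0:ℝ) < T - t₀ by linarith))).exists
  set κ' := κ - e with hκ'
  set T' := T - e with hT'
  have ht0T' : t₀ < T' := by have := he2.2; linarith
  have hT'T : T' < T := by have := he2.1; linarith
  have hcont : ContinuousOn (fun p : ℝ × ℝ => E p.1 p.2 + κ' * p.2)
      (Icc (0:ℝ) (2 * π) ×ˢ Icc t₀ T') := by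
    refine ContinuousOn.add (hE.cont.mono ?_) (by fun_prop)
    rintro ⟨x, t⟩ ⟨-, hx⟩
    exact ⟨mem_univ _, h0.le.trans hx.1, lt_of_le_of_lt hx.2 hT'T⟩
  have hK : IsCompact (Icc (0:ℝ) (2 * π) ×ˢ Icc t₀ T') := isCompact_Icc.prod isCompact_Icc
  have hZ1 : IsCompact ((Icc (0:ℝ) (2 * π) ×ˢ Icc t₀ T') ∩
      (fun p : ℝ × ℝ => E p.1 p.2 + κ' * p.2) ⁻¹' Iic (κ' * T')) :=
    hK.of_isClosed_subset (hcont.preimage_isClosed_of_isClosed hK.isClosed isClosed_Iic)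
      inter_subset_left
  have hperf : ∀ t, Function.Periodic (fun x => E x t) (2 * π) := fun t x => hper x t
  obtain ⟨y₀, hy₀, hxy₀⟩ := (hperf t₀).exists_mem_Ico₀ (by positivity) ξ₀
  have hxy0' : E ξ₀ t₀ = E y₀ t₀ := hxy₀
  obtain ⟨⟨x, t⟩, ⟨⟨hx, ht⟩, hle⟩, hmax⟩ := hZ1.exists_isMaxOn
    ⟨(y₀, t₀), ⟨⟨hy₀.1, hy₀.2.le⟩, le_rfl, ht0T'.le⟩, by
      simp only [mem_preimage, mem_Iic]; rw [← hxy0']; nlinarith⟩ continuous_snd.continuousOn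
  simp only [mem_preimage, mem_Iic] at hx ht hle
  have htp : 0 < t := lt_of_lt_of_le h0 ht.1
  have htT : t < T := lt_of_le_of_lt ht.2 hT'T
  have htT' : t < T' := by
    rcases ht.2.eq_or_lt with h' | h'
    · rw [h'] at hle htT
      have := hpos x T' (by linarith) htT
      linarith
    · exact h'
  have hc2 : ContinuousOn (fun z => E z t) (Icc (0:ℝ) (2 * π)) := fun z _ =>
    (hE.hs (ξ := z) htp.le htT).continuousAt.continuousWithinAt
  obtain ⟨z, hz, hzmin⟩ := isCompact_Icc.exists_isMinOn
    (⟨0, le_rfl, by positivity⟩ : (Icc (0:ℝ) (2 * π)).Nonempty) hc2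
  have hzmin' : ∀ y, E z t ≤ E y t := by
    intro y
    obtain ⟨y', hy', hyy⟩ := (hperf t).exists_mem_Ico₀ (by positivity) y
    have hyy' : E y t = E y' t := hyy
    rw [hyy']
    exact hzmin ⟨hy'.1, hy'.2.le⟩
  have hd := hr z t htp htT hzmin'
  have hder2 : HasDerivAt (fun τ => E z τ + κ' * τ) (pdt E z t + κ') t := by
    have := (hE.ht (ξ := z) htp htT).add ((hasDerivAt_id t).const_mul κ')
    rw [mul_one] at this; exact this
  have hneg : pdt E z t + κ' < 0 := by have := he2.1; linarith
  have hs := (hasDerivAt_iff_tendsto_slope_left_right.1 hder2).2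
  obtain ⟨τ, hτ1, hτ2⟩ := ((hs.eventually (gt_mem_nhds hneg)).and (Ioo_mem_nhdsGT htT')).exists
  rw [slope_def_field, div_neg_iff] at hτ1
  have hτ3 : E z τ + κ' * τ < E z t + κ' * t := by
    rcases hτ1 with h' | h'
    · linarith [h'.2, hτ2.1]
    · linarith [h'.1]
  have := hmax (show (z, τ) ∈ _ from ⟨⟨hz, ht.1.trans hτ2.1.le, hτ2.2.le⟩, by
    simp only [mem_preimage, mem_Iic]; linarith [hzmin' x]⟩)
  simp only [mem_ofPred_eq] at this
  linarith [hτ2.1]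

end rules

/-- `f²/g⁴` -/
def PP (A B : ℝ → ℝ → ℝ) : ℝ → ℝ → ℝ := eX ((2:ℝ) • A - (4:ℝ) • B)
/-- `1/g²` -/
def QQ (B : ℝ → ℝ → ℝ) : ℝ → ℝ → ℝ := eX ((-2:ℝ) • B)
/-- drift -/
def nn (ρ A B : ℝ → ℝ → ℝ) : ℝ → ℝ → ℝ := Ds ρ A + (2:ℝ) • Ds ρ B
/-- sum of squares -/
def cc (ρ A B : ℝ → ℝ → ℝ) : ℝ → ℝ → ℝ := Ds ρ A * Ds ρ A + (2:ℝ) • (Ds ρ B * Ds ρ B)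
/-- source of `a` -/
def Fa (ρ A B : ℝ → ℝ → ℝ) : ℝ → ℝ → ℝ :=
  (-2:ℝ) • (PP A B * ((2:ℝ) • Ds ρ A - (4:ℝ) • Ds ρ B)) - cc ρ A B * Ds ρ A
/-- source of `b` -/
def Fb (ρ A B : ℝ → ℝ → ℝ) : ℝ → ℝ → ℝ :=
  (2:ℝ) • (PP A B * ((2:ℝ) • Ds ρ A - (4:ℝ) • Ds ρ B)) + (8:ℝ) • (QQ B * Ds ρ B)
    - cc ρ A B * Ds ρ B

/-- The flow in logarithmic variables. -/
structure Geo (T : ℝ) (ρ A B : ℝ → ℝ → ℝ) : Prop where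
  bg : Bg T ρ (nn ρ A B) (cc ρ A B)
  hA : Heat T ρ (nn ρ A B) A ((-2:ℝ) • PP A B)
  hB : Heat T ρ (nn ρ A B) B ((2:ℝ) • PP A B - (4:ℝ) • QQ B)

lemma Heat.congr {T : ℝ} {ρ n φ Φ Φ' : ℝ → ℝ → ℝ} (h : Heat T ρ n φ Φ)
    (he : ∀ ξ t, 0 < t → t < T → Φ ξ t = Φ' ξ t) : Heat T ρ n φ Φ' where
  sm := h.sm
  per := h.per
  eq ξ t h0 hT := by rw [h.eq ξ t h0 hT, he ξ t h0 hT]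

section geo
variable {T : ℝ} {ρ A B : ℝ → ℝ → ℝ}

lemma Geo.sA (G : Geo T ρ A B) : Sm T A := G.hA.sm
lemma Geo.sB (G : Geo T ρ A B) : Sm T B := G.hB.sm
lemma Geo.sa (G : Geo T ρ A B) : Sm T (Ds ρ A) := G.hA.sm.Ds G.bg
lemma Geo.sb (G : Geo T ρ A B) : Sm T (Ds ρ B) := G.hB.sm.Ds G.bg
lemma Geo.sP (G : Geo T ρ A B) : Sm T (PP A B) := ((G.sA.smul 2).sub (G.sB.smul 4)).eX
lemma Geo.sQ (G : Geo T ρ A B) : Sm T (QQ B) := (G.sB.smul (-2)).eX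

lemma Geo.dP (G : Geo T ρ A B) {ξ t : ℝ} (h0 : 0 ≤ t) (hT : t < T) :
    Ds ρ (PP A B) ξ t = PP A B ξ t * (2 * Ds ρ A ξ t - 4 * Ds ρ B ξ t) := by
  rw [PP, Ds_eX ((G.sA.smul 2).sub (G.sB.smul 4)) h0 hT, Ds_sub (G.sA.smul 2) (G.sB.smul 4) h0 hT,
    Ds_smul 2 G.sA h0 hT, Ds_smul 4 G.sB h0 hT]

lemma Geo.dQ (G : Geo T ρ A B) {ξ t : ℝ} (h0 : 0 ≤ t) (hT : t < T) :
    Ds ρ (QQ B) ξ t = QQ B ξ t * (-2 * Ds ρ B ξ t) := by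
  rw [QQ, Ds_eX (G.sB.smul (-2)) h0 hT, Ds_smul (-2) G.sB h0 hT]

lemma Geo.ha (G : Geo T ρ A B) : Heat T ρ (nn ρ A B) (Ds ρ A) (Fa ρ A B) := by
  refine (G.hA.Ds G.bg (G.sP.smul (-2))).congr ?_
  intro ξ t h0 hT
  simp only [Fa, Pi.sub_apply, Pi.smul_apply, Pi.mul_apply, smul_eq_mul]
  rw [Ds_smul (-2) G.sP h0.le hT, G.dP h0.le hT]

lemma Geo.hb (G : Geo T ρ A B) : Heat T ρ (nn ρ A B) (Ds ρ B) (Fb ρ A B) := by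
  refine (G.hB.Ds G.bg ((G.sP.smul 2).sub (G.sQ.smul 4))).congr ?_
  intro ξ t h0 hT
  simp only [Fb, Pi.sub_apply, Pi.add_apply, Pi.smul_apply, Pi.mul_apply, smul_eq_mul]
  rw [Ds_sub (G.sP.smul 2) (G.sQ.smul 4) h0.le hT, Ds_smul 2 G.sP h0.le hT,
    Ds_smul 4 G.sQ h0.le hT, G.dP h0.le hT, G.dQ h0.le hT]
  ring

lemma PP_pos (A B : ℝ → ℝ → ℝ) (ξ t : ℝ) : 0 < PP A B ξ t := Real.exp_pos _
lemma QQ_pos (B : ℝ → ℝ → ℝ) (ξ t : ℝ) : 0 < QQ B ξ t := Real.exp_pos _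
lemma eX_pos (B : ℝ → ℝ → ℝ) (ξ t : ℝ) : 0 < eX B ξ t := Real.exp_pos _

lemma Geo.ord (G : Geo T ρ A B) (hi : ∀ ξ, A ξ 0 ≤ B ξ 0) :
    ∀ ξ t, 0 ≤ t → t < T → A ξ t ≤ B ξ t := by
  have := max_principle G.bg (G.hA.sub G.bg G.hB) 0 (fun ξ => by
    simp only [Pi.sub_apply]; linarith [hi ξ]) (by
    intro ξ t h0 hT hK _
    simp only [Pi.sub_apply, Pi.smul_apply, smul_eq_mul] at *
    have : QQ B ξ t ≤ PP A B ξ t := by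
      simp only [QQ, PP, eX, Pi.sub_apply, Pi.smul_apply, smul_eq_mul]
      apply Real.exp_le_exp.2; linarith
    linarith)
  intro ξ t h0 hT
  have := this ξ t h0 hT
  simp only [Pi.sub_apply] at this
  linarith

lemma PQ_le {ξ t : ℝ} (h : A ξ t ≤ B ξ t) : PP A B ξ t ≤ QQ B ξ t := by
  simp only [QQ, PP, eX, Pi.sub_apply, Pi.smul_apply, smul_eq_mul]
  apply Real.exp_le_exp.2; linarith

lemma Geo.pinch (G : Geo T ρ A B) (ho : ∀ ξ t, 0 ≤ t → t < T → A ξ t ≤ B ξ t) (K : ℝ)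
    (hi : ∀ ξ, B ξ 0 - A ξ 0 ≤ K) : ∀ ξ t, 0 ≤ t → t < T → B ξ t - A ξ t ≤ K := by
  exact max_principle G.bg (G.hB.sub G.bg G.hA) K hi (by
    intro ξ t h0 hT _ _
    simp only [Pi.sub_apply, Pi.smul_apply, smul_eq_mul] at *
    have := PQ_le (ho ξ t h0.le hT)
    linarith)

lemma Geo.fs (G : Geo T ρ A B) (ho : ∀ ξ t, 0 ≤ t → t < T → A ξ t ≤ B ξ t)
    (hi : ∀ ξ, (Ds ρ A * Ds ρ A * eX ((2:ℝ) • A)) ξ 0 ≤ 4 / 3) :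
    ∀ ξ t, 0 ≤ t → t < T → (Ds ρ A * Ds ρ A * eX ((2:ℝ) • A)) ξ t ≤ 4 / 3 := by
  refine max_principle G.bg ((G.ha.mul G.bg G.ha).mul G.bg ((G.hA.smul G.bg 2).eX G.bg)) (4/3) hi ?_
  intro ξ t h0 hT hK hc
  rw [Ds_mul (G.sa.mul G.sa) (G.sA.smul 2).eX h0.le hT, Ds_mul G.sa G.sa h0.le hT,
    Ds_eX (G.sA.smul 2) h0.le hT, Ds_smul 2 G.sA h0.le hT] at hc
  simp only [Fa, cc, Pi.sub_apply, Pi.add_apply, Pi.smul_apply, Pi.mul_apply, smul_eq_mul] at *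
  rw [Ds_mul G.sa G.sa h0.le hT, Ds_eX (G.sA.smul 2) h0.le hT, Ds_smul 2 G.sA h0.le hT]
  have hpq := PQ_le (ho ξ t h0.le hT)
  have hp := PP_pos A B ξ t
  have hq := QQ_pos B ξ t
  have hE := eX_pos ((2:ℝ) • A) ξ t
  have hrel : eX ((2:ℝ) • A) ξ t * QQ B ξ t ^ 2 = PP A B ξ t := by
    simp only [QQ, PP, eX, Pi.sub_apply, Pi.smul_apply, smul_eq_mul]
    rw [sq, ← Real.exp_add, ← Real.exp_add]; congr 1; ring
  generalize PP A B ξ t = p at *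
  generalize QQ B ξ t = q at *
  generalize eX ((2:ℝ) • A) ξ t = E at *
  generalize Ds ρ (Ds ρ A) ξ t = α1 at *
  generalize Ds ρ A ξ t = α at *
  generalize Ds ρ B ξ t = β at *
  have hα : α ≠ 0 := by rintro rfl; norm_num at hK
  have h1 : α1 = -α ^ 2 := by
    have : (2 * E * α) * (α1 + α ^ 2) = 0 := by linear_combination hc
    rcases mul_eq_zero.1 this with h | h
    · exact absurd h (by positivity)
    · linarith
  subst h1
  have key : 4 / 3 * p ≤ α ^ 2 := by
    have h2 : α ^ 2 * p = (α * α * E) * q ^ 2 := by rw [← hrel]; ring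
    have h3 : 4 / 3 * q ^ 2 ≤ α ^ 2 * p := by rw [h2]; nlinarith [sq_nonneg q]
    have h4 : 4 / 3 * p * p ≤ α ^ 2 * p := by nlinarith
    exact le_of_mul_le_mul_right h4 hp
  have : E * (-4 * α ^ 2 * β ^ 2 - 12 * p * α ^ 2 + 16 * p * α * β) ≤ 0 := by
    apply mul_nonpos_of_nonneg_of_nonpos hE.le
    nlinarith [sq_nonneg (α * β - 2 * p)]
  linear_combination this

lemma Geo.gs (G : Geo T ρ A B) (ho : ∀ ξ t, 0 ≤ t → t < T → A ξ t ≤ B ξ t) (K : ℝ) (hK5 : 5 ≤ K)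
    (hi : ∀ ξ, (Ds ρ B * Ds ρ B * eX ((2:ℝ) • B)) ξ 0 ≤ K) :
    ∀ ξ t, 0 ≤ t → t < T → (Ds ρ B * Ds ρ B * eX ((2:ℝ) • B)) ξ t ≤ K := by
  refine max_principle G.bg ((G.hb.mul G.bg G.hb).mul G.bg ((G.hB.smul G.bg 2).eX G.bg)) K hi ?_
  intro ξ t h0 hT hK hc
  rw [Ds_mul (G.sb.mul G.sb) (G.sB.smul 2).eX h0.le hT, Ds_mul G.sb G.sb h0.le hT,
    Ds_eX (G.sB.smul 2) h0.le hT, Ds_smul 2 G.sB h0.le hT] at hc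
  simp only [Fb, cc, Pi.sub_apply, Pi.add_apply, Pi.smul_apply, Pi.mul_apply, smul_eq_mul] at *
  rw [Ds_mul G.sb G.sb h0.le hT, Ds_eX (G.sB.smul 2) h0.le hT, Ds_smul 2 G.sB h0.le hT]
  have hpq := PQ_le (ho ξ t h0.le hT)
  have hp := PP_pos A B ξ t
  have hq := QQ_pos B ξ t
  have hE := eX_pos ((2:ℝ) • B) ξ t
  have hrel : eX ((2:ℝ) • B) ξ t * QQ B ξ t = 1 := by
    simp only [QQ, eX, Pi.smul_apply, smul_eq_mul]
    rw [← Real.exp_add, ← Real.exp_zero]; congr 1; ring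
  generalize PP A B ξ t = p at *
  generalize QQ B ξ t = q at *
  generalize eX ((2:ℝ) • B) ξ t = E at *
  generalize Ds ρ (Ds ρ B) ξ t = β1 at *
  generalize Ds ρ A ξ t = α at *
  generalize Ds ρ B ξ t = β at *
  have hβ : β ≠ 0 := by rintro rfl; norm_num at hK; linarith
  have h1 : β1 = -β ^ 2 := by
    have : (2 * E * β) * (β1 + β ^ 2) = 0 := by linear_combination hc
    rcases mul_eq_zero.1 this with h | h
    · exact absurd h (by positivity)
    · linarith
  subst h1
  have key : 5 * q ≤ β ^ 2 := by
    have h2 : β ^ 2 = (β * β * E) * q := by linear_combination (-β ^ 2) * hrel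
    rw [h2]; nlinarith
  have : E * (-2 * α ^ 2 * β ^ 2 - 2 * β ^ 4 + 8 * p * α * β - 12 * p * β ^ 2 + 8 * q * β ^ 2) ≤ 0 := by
    apply mul_nonpos_of_nonneg_of_nonpos hE.le
    have k1 : p ^ 2 ≤ q ^ 2 := by nlinarith
    have k2 : 5 * q * β ^ 2 ≤ β ^ 4 := by nlinarith [sq_nonneg β]
    have k3 : 5 * q * q ≤ q * β ^ 2 := by nlinarith
    have k4 : 0 ≤ p * β ^ 2 := by positivity
    nlinarith [sq_nonneg (α * β - 2 * p)]
  linear_combination this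

lemma Geo.WW (G : Geo T ρ A B) (ho : ∀ ξ t, 0 ≤ t → t < T → A ξ t ≤ B ξ t)
    (hl : ∀ ξ t, 0 ≤ t → t < T → 2 / 3 * eX B ξ t ≤ eX A ξ t)
    (hfs : ∀ ξ t, 0 ≤ t → t < T → (Ds ρ A * Ds ρ A * eX ((2:ℝ) • A)) ξ t ≤ 4 / 3) (K : ℝ)
    (hi : ∀ ξ, (eX (B - (2:ℝ) • A) - eX ((-1:ℝ) • A)) ξ 0 ≤ K) :
    ∀ ξ t, 0 ≤ t → t < T → (eX (B - (2:ℝ) • A) - eX ((-1:ℝ) • A)) ξ t ≤ K := by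
  refine max_principle G.bg (((G.hB.sub G.bg (G.hA.smul G.bg 2)).eX G.bg).sub G.bg
    ((G.hA.smul G.bg (-1)).eX G.bg)) K hi ?_
  intro ξ t h0 hT hK hc
  rw [Ds_sub (G.sB.sub (G.sA.smul 2)).eX (G.sA.smul (-1)).eX h0.le hT,
    Ds_eX (G.sB.sub (G.sA.smul 2)) h0.le hT, Ds_eX (G.sA.smul (-1)) h0.le hT,
    Ds_sub G.sB (G.sA.smul 2) h0.le hT, Ds_smul 2 G.sA h0.le hT, Ds_smul (-1) G.sA h0.le hT] at hc
  have hfs' := hfs ξ t h0.le hT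
  simp only [Pi.sub_apply, Pi.add_apply, Pi.smul_apply, Pi.mul_apply, smul_eq_mul] at *
  rw [Ds_sub G.sB (G.sA.smul 2) h0.le hT, Ds_smul 2 G.sA h0.le hT, Ds_smul (-1) G.sA h0.le hT]
  have hx := eX_pos A ξ t
  have hy := eX_pos B ξ t
  have hxy : eX A ξ t ≤ eX B ξ t := Real.exp_le_exp.2 (ho ξ t h0.le hT)
  have hl' := hl ξ t h0.le hT
  have r1 : eX (B - (2:ℝ) • A) ξ t = eX B ξ t / eX A ξ t ^ 2 := by
    simp only [eX, Pi.sub_apply, Pi.smul_apply, smul_eq_mul]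
    rw [← Real.exp_nat_mul, ← Real.exp_sub]; norm_num
  have r2 : eX ((-1:ℝ) • A) ξ t = 1 / eX A ξ t := by
    simp only [eX, Pi.smul_apply, smul_eq_mul]
    rw [neg_one_mul, Real.exp_neg, one_div]
  have r3 : eX ((2:ℝ) • A) ξ t = eX A ξ t ^ 2 := by
    simp only [eX, Pi.smul_apply, smul_eq_mul]
    rw [← Real.exp_nat_mul]; norm_num
  have r4 : PP A B ξ t = eX A ξ t ^ 2 / eX B ξ t ^ 4 := by
    simp only [PP, eX, Pi.sub_apply, Pi.smul_apply, smul_eq_mul]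
    rw [← Real.exp_nat_mul, ← Real.exp_nat_mul, ← Real.exp_sub]; norm_num
  have r5 : QQ B ξ t = 1 / eX B ξ t ^ 2 := by
    simp only [QQ, eX, Pi.smul_apply, smul_eq_mul]
    rw [← Real.exp_nat_mul, one_div, ← Real.exp_neg]; norm_num
  rw [r1, r2] at hc
  rw [r3] at hfs'
  rw [r1, r2, r4, r5]
  generalize eX A ξ t = x at *
  generalize eX B ξ t = y at *
  generalize Ds ρ A ξ t = α at *
  generalize Ds ρ B ξ t = β at *
  have hβ : β = 2 * α - α * x / y := by
    field_simp at hc ⊢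
    linear_combination hc
  subst hβ
  have e : y / x ^ 2 * (2 * (x ^ 2 / y ^ 4) - 4 * (1 / y ^ 2) - 2 * (-2 * (x ^ 2 / y ^ 4)) -
        (2 * α - α * x / y - 2 * α) * (2 * α - α * x / y - 2 * α)) -
      1 / x * (-1 * (-2 * (x ^ 2 / y ^ 4)) - -1 * α * (-1 * α))
      = (y - x) / (x ^ 3 * y ^ 4) * ((α * α * x ^ 2) * y ^ 3 + 2 * x ^ 3 - 4 * x ^ 2 * y - 4 * x * y ^ 2) := by
    field_simp
    ring
  have e2 : (y - x) / (x ^ 3 * y ^ 4) * ((α * α * x ^ 2) * y ^ 3 + 2 * x ^ 3 - 4 * x ^ 2 * y - 4 * x * y ^ 2) ≤ 0 := by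
    apply mul_nonpos_of_nonneg_of_nonpos
    · apply div_nonneg <;> [linarith; positivity]
    · have : α * α * x ^ 2 * y ^ 3 ≤ 4 / 3 * y ^ 3 := by gcongr
      nlinarith [mul_pos hx hy, sq_nonneg x, sq_nonneg y, mul_pos (mul_pos hx hx) hx, mul_le_mul_of_nonneg_left hxy (sq_nonneg x), mul_le_mul_of_nonneg_left hl' (sq_nonneg y)]
  exact e.trans_le e2

lemma Geo.dd (G : Geo T ρ A B) (K1 K : ℝ) (hK1 : 0 ≤ K1) (hK2 : (9 / 4 * K1) ^ 2 ≤ K)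
    (hPQ : ∀ ξ t, 0 ≤ t → t < T → 4 / 9 * QQ B ξ t ≤ PP A B ξ t)
    (hb : ∀ ξ t, 0 ≤ t → t < T → |Ds ρ B ξ t * (QQ B ξ t - PP A B ξ t)| ≤ K1 * QQ B ξ t)
    (hi : ∀ ξ, ((Ds ρ B - Ds ρ A) * (Ds ρ B - Ds ρ A)) ξ 0 ≤ K) :
    ∀ ξ t, 0 ≤ t → t < T → ((Ds ρ B - Ds ρ A) * (Ds ρ B - Ds ρ A)) ξ t ≤ K := by
  have hd := G.hb.sub G.bg G.ha
  refine max_principle G.bg (hd.mul G.bg hd) K hi ?_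
  intro ξ t h0 hT hK _
  simp only [Fa, Fb, cc, Pi.sub_apply, Pi.add_apply, Pi.smul_apply, Pi.mul_apply, smul_eq_mul] at *
  have h1 := hPQ ξ t h0.le hT
  have h2 := hb ξ t h0.le hT
  have hq := QQ_pos B ξ t
  generalize Ds ρ (Ds ρ B - Ds ρ A) ξ t = δ at *
  generalize PP A B ξ t = p at *
  generalize QQ B ξ t = q at *
  generalize Ds ρ A ξ t = α at *
  generalize Ds ρ B ξ t = β at *
  have hd1 : 9 / 4 * K1 ≤ |β - α| := by
    apply le_of_lt
    apply lt_of_pow_lt_pow_left₀ 2 (abs_nonneg _)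
    rw [sq_abs]; nlinarith
  have hd2 : (β - α) * (β * (q - p)) ≤ |β - α| * (K1 * q) := by
    calc _ ≤ |(β - α) * (β * (q - p))| := le_abs_self _
      _ = |β - α| * |β * (q - p)| := abs_mul _ _
      _ ≤ _ := by gcongr
  have hd3 : |β - α| * (K1 * q) ≤ p * (β - α) ^ 2 := by
    rw [← sq_abs (β - α)]
    have : K1 * q ≤ p * |β - α| := by nlinarith [abs_nonneg (β - α)]
    nlinarith [abs_nonneg (β - α)]
  have e4 : 0 ≤ (α ^ 2 + 2 * β ^ 2) * (β - α) ^ 2 := by positivity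
  nlinarith [sq_nonneg δ]

lemma Geo.gmax (G : Geo T ρ A B) (ho : ∀ ξ t, 0 ≤ t → t < T → A ξ t ≤ B ξ t) (K : ℝ)
    (hi : ∀ ξ, eX ((2:ℝ) • B) ξ 0 ≤ K) :
    ∀ ξ t, 0 ≤ t → t < T → eX ((2:ℝ) • B) ξ t ≤ K := by
  refine max_principle G.bg ((G.hB.smul G.bg 2).eX G.bg) K hi ?_
  intro ξ t h0 hT hK _
  simp only [Pi.sub_apply, Pi.smul_apply, Pi.mul_apply, smul_eq_mul] at *
  apply mul_nonpos_of_nonneg_of_nonpos (eX_pos _ _ _).le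
  have := PQ_le (ho ξ t h0.le hT)
  have := QQ_pos B ξ t
  nlinarith [mul_self_nonneg (Ds ρ ((2:ℝ) • B) ξ t)]

/-- minus the scalar curvature -/
def mR (ρ A B : ℝ → ℝ → ℝ) : ℝ → ℝ → ℝ :=
  Ds ρ (Ds ρ A) + (2:ℝ) • Ds ρ (Ds ρ B) + Ds ρ A * Ds ρ A + (3:ℝ) • (Ds ρ B * Ds ρ B)
    + (2:ℝ) • (Ds ρ A * Ds ρ B) - (4:ℝ) • QQ B + PP A B

lemma Geo.sc (G : Geo T ρ A B) : Sm T (cc ρ A B) := (G.sa.mul G.sa).add ((G.sb.mul G.sb).smul 2)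

lemma Geo.sFa (G : Geo T ρ A B) : Sm T (Fa ρ A B) :=
  ((G.sP.mul ((G.sa.smul 2).sub (G.sb.smul 4))).smul (-2)).sub (G.sc.mul G.sa)

lemma Geo.sFb (G : Geo T ρ A B) : Sm T (Fb ρ A B) :=
  (((G.sP.mul ((G.sa.smul 2).sub (G.sb.smul 4))).smul 2).add
    ((G.sQ.mul G.sb).smul 8)).sub (G.sc.mul G.sb)

lemma Geo.dc (G : Geo T ρ A B) {ξ t : ℝ} (h0 : 0 ≤ t) (hT : t < T) :
    Ds ρ (cc ρ A B) ξ t = 2 * Ds ρ A ξ t * Ds ρ (Ds ρ A) ξ t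
      + 4 * Ds ρ B ξ t * Ds ρ (Ds ρ B) ξ t := by
  rw [cc, Ds_add (G.sa.mul G.sa) ((G.sb.mul G.sb).smul 2) h0 hT, Ds_mul G.sa G.sa h0 hT,
    Ds_smul 2 (G.sb.mul G.sb) h0 hT, Ds_mul G.sb G.sb h0 hT]
  ring

lemma Geo.dPab (G : Geo T ρ A B) {ξ t : ℝ} (h0 : 0 ≤ t) (hT : t < T) :
    Ds ρ (PP A B * ((2:ℝ) • Ds ρ A - (4:ℝ) • Ds ρ B)) ξ t =
      PP A B ξ t * (2 * Ds ρ A ξ t - 4 * Ds ρ B ξ t) ^ 2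
      + PP A B ξ t * (2 * Ds ρ (Ds ρ A) ξ t - 4 * Ds ρ (Ds ρ B) ξ t) := by
  rw [Ds_mul G.sP ((G.sa.smul 2).sub (G.sb.smul 4)) h0 hT, G.dP h0 hT,
    Ds_sub (G.sa.smul 2) (G.sb.smul 4) h0 hT, Ds_smul 2 G.sa h0 hT, Ds_smul 4 G.sb h0 hT]
  simp only [Pi.sub_apply, Pi.smul_apply, smul_eq_mul]
  ring

lemma Geo.Rmin (G : Geo T ρ A B) (K : ℝ) (hi : ∀ ξ, mR ρ A B ξ 0 ≤ K) :
    ∀ ξ t, 0 ≤ t → t < T → mR ρ A B ξ t ≤ K := by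
  have b := G.bg
  have H1 := G.ha.Ds b G.sFa
  have H2 := (G.hb.Ds b G.sFb).smul b 2
  have H3 := G.ha.mul b G.ha
  have H4 := (G.hb.mul b G.hb).smul b 3
  have H5 := (G.ha.mul b G.hb).smul b 2
  have HQ := ((G.hB.smul b (-2)).eX b).smul b 4
  have HP := ((G.hA.smul b 2).sub b (G.hB.smul b 4)).eX b
  have H := (((((H1.add b H2).add b H3).add b H4).add b H5).sub b HQ).add b HP
  refine max_principle b H K hi ?_
  intro ξ t h0 hT hK _
  have d1 : Ds ρ (Fa ρ A B) ξ t = -2 * (PP A B ξ t * (2 * Ds ρ A ξ t - 4 * Ds ρ B ξ t) ^ 2 + PP A B ξ t * (2 * Ds ρ (Ds ρ A) ξ t - 4 * Ds ρ (Ds ρ B) ξ t)) -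
      (cc ρ A B ξ t * Ds ρ (Ds ρ A) ξ t + Ds ρ A ξ t * (2 * Ds ρ A ξ t * Ds ρ (Ds ρ A) ξ t + 4 * Ds ρ B ξ t * Ds ρ (Ds ρ B) ξ t)) := by
    rw [Fa, Ds_sub ((G.sP.mul ((G.sa.smul 2).sub (G.sb.smul 4))).smul (-2)) (G.sc.mul G.sa) h0.le hT,
      Ds_smul (-2) (G.sP.mul ((G.sa.smul 2).sub (G.sb.smul 4))) h0.le hT, G.dPab h0.le hT,
      Ds_mul G.sc G.sa h0.le hT, G.dc h0.le hT]
  have d2 : Ds ρ (Fb ρ A B) ξ t = 2 * (PP A B ξ t * (2 * Ds ρ A ξ t - 4 * Ds ρ B ξ t) ^ 2 + PP A B ξ t * (2 * Ds ρ (Ds ρ A) ξ t - 4 * Ds ρ (Ds ρ B) ξ t)) +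
      8 * (QQ B ξ t * Ds ρ (Ds ρ B) ξ t + Ds ρ B ξ t * (QQ B ξ t * (-2 * Ds ρ B ξ t))) -
      (cc ρ A B ξ t * Ds ρ (Ds ρ B) ξ t + Ds ρ B ξ t * (2 * Ds ρ A ξ t * Ds ρ (Ds ρ A) ξ t + 4 * Ds ρ B ξ t * Ds ρ (Ds ρ B) ξ t)) := by
    rw [Fb, Ds_sub (((G.sP.mul ((G.sa.smul 2).sub (G.sb.smul 4))).smul 2).add
        ((G.sQ.mul G.sb).smul 8)) (G.sc.mul G.sb) h0.le hT,
      Ds_add ((G.sP.mul ((G.sa.smul 2).sub (G.sb.smul 4))).smul 2) ((G.sQ.mul G.sb).smul 8) h0.le hT,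
      Ds_smul 2 (G.sP.mul ((G.sa.smul 2).sub (G.sb.smul 4))) h0.le hT, G.dPab h0.le hT,
      Ds_smul 8 (G.sQ.mul G.sb) h0.le hT, Ds_mul G.sQ G.sb h0.le hT, G.dQ h0.le hT,
      Ds_mul G.sc G.sb h0.le hT, G.dc h0.le hT]
  have d3 : Ds ρ ((-2:ℝ) • B) ξ t = -2 * Ds ρ B ξ t := Ds_smul (-2) G.sB h0.le hT
  have d4 : Ds ρ ((2:ℝ) • A - (4:ℝ) • B) ξ t = 2 * Ds ρ A ξ t - 4 * Ds ρ B ξ t := by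
    rw [Ds_sub (G.sA.smul 2) (G.sB.smul 4) h0.le hT, Ds_smul 2 G.sA h0.le hT,
      Ds_smul 4 G.sB h0.le hT]
  simp only [Pi.sub_apply, Pi.add_apply, Pi.smul_apply, Pi.mul_apply, smul_eq_mul]
  rw [d1, d2, d3, d4]
  have e1 : eX ((-2:ℝ) • B) ξ t = QQ B ξ t := rfl
  have e2 : eX ((2:ℝ) • A - (4:ℝ) • B) ξ t = PP A B ξ t := rfl
  rw [e1, e2]
  simp only [Fa, Fb, cc, Pi.sub_apply, Pi.add_apply, Pi.smul_apply, Pi.mul_apply, smul_eq_mul]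
  generalize PP A B ξ t = p at *
  generalize QQ B ξ t = q at *
  generalize Ds ρ (Ds ρ A) ξ t = α1 at *
  generalize Ds ρ (Ds ρ B) ξ t = β1 at *
  generalize Ds ρ A ξ t = α at *
  generalize Ds ρ B ξ t = β at *
  have hs : -((α1 + 2 * β1 + α ^ 2 + 2 * β ^ 2) ^ 2 + (α1 + (α + 2 * β) * α - 2 * p) ^ 2
     + 2 * (β1 + (α + 2 * β) * β + 2 * p - 4 * q) ^ 2) ≤ 0 := by
    rw [neg_nonpos]; positivity
  refine le_trans (le_of_eq ?_) hs
  ring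

lemma Geo.rate (G : Geo T ρ A B) (ho : ∀ ξ t, 0 ≤ t → t < T → A ξ t ≤ B ξ t)
    (r G2 : ℝ) (hR : ∀ ξ t, 0 ≤ t → t < T → mR ρ A B ξ t ≤ -r)
    (hg : ∀ ξ t, 0 ≤ t → t < T → eX ((2:ℝ) • B) ξ t ≤ G2) (hrG : -3 < r * G2)
    (hl : ∀ ξ t, 0 ≤ t → t < T → 2 / 3 * eX B ξ t ≤ eX A ξ t) :
    ∃ κ : ℝ, 0 < κ ∧ ∀ ξ t, 0 < t → t < T → κ * (T - t) ≤ eX ((2 / 3 : ℝ) • (A + (2:ℝ) • B)) ξ t := by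
  set e := min 3 (3 + r * G2) with he
  have hep : 0 < e := lt_min (by norm_num) (by linarith)
  have sE : Sm T (A + (2:ℝ) • B) := G.sA.add (G.sB.smul 2)
  refine ⟨2 / 3 * (2 / 3 * e), by positivity, ?_⟩
  refine min_rate (sE.smul (2/3)).eX ?_ (fun ξ t _ _ => eX_pos _ _ _) _ ?_
  · intro ξ t
    simp only [eX, Pi.add_apply, Pi.smul_apply, G.hA.per, G.hB.per]
  intro ξ t h0 hT hmin
  have hmax : ∀ y, ((-1:ℝ) • (A + (2:ℝ) • B)) y t ≤ ((-1:ℝ) • (A + (2:ℝ) • B)) ξ t := by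
    intro y
    have := Real.exp_le_exp.1 (hmin y)
    simp only [Pi.add_apply, Pi.smul_apply, smul_eq_mul] at this ⊢
    linarith
  have hc := (crit_of_max G.bg (sE.smul (-1)) h0.le hT hmax).1
  rw [Ds_smul (-1) sE h0.le hT, Ds_add G.sA (G.sB.smul 2) h0.le hT, Ds_smul 2 G.sB h0.le hT] at hc
  rw [pdt_eX (sE.smul (2/3)) h0 hT, pdt_smul (2/3) sE h0 hT, pdt_add G.sA (G.sB.smul 2) h0 hT,
    pdt_smul 2 G.sB h0 hT, G.hA.eq ξ t h0 hT, G.hB.eq ξ t h0 hT]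
  have hR' := hR ξ t h0.le hT
  have hg' := hg ξ t h0.le hT
  have hq := QQ_pos B ξ t
  have hpq := PQ_le (ho ξ t h0.le hT)
  have hrel : eX ((2:ℝ) • B) ξ t * QQ B ξ t = 1 := by
    simp only [QQ, eX, Pi.smul_apply, smul_eq_mul]
    rw [← Real.exp_add, ← Real.exp_zero]; congr 1; ring
  have hE : 2 / 3 * eX ((2:ℝ) • B) ξ t ≤ eX ((2 / 3 : ℝ) • (A + (2:ℝ) • B)) ξ t := by
    have h1 : Real.log (2/3) + B ξ t ≤ A ξ t := by
      have := Real.log_le_log (mul_pos (by norm_num) (eX_pos B ξ t)) (hl ξ t h0.le hT)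
      rw [Real.log_mul (by norm_num) (eX_pos B ξ t).ne'] at this
      simpa [eX] using this
    have h2 : Real.log (2/3) ≤ 0 := Real.log_nonpos (by norm_num) (by norm_num)
    calc 2 / 3 * eX ((2:ℝ) • B) ξ t = Real.exp (Real.log (2/3)) * Real.exp (2 * B ξ t) := by
          rw [Real.exp_log (by norm_num)]; rfl
      _ = Real.exp (Real.log (2/3) + 2 * B ξ t) := by rw [Real.exp_add]
      _ ≤ _ := by
        apply Real.exp_le_exp.2
        simp only [Pi.add_apply, Pi.smul_apply, smul_eq_mul]
        linarith
  simp only [mR, nn, Pi.sub_apply, Pi.add_apply, Pi.smul_apply, Pi.mul_apply, smul_eq_mul] at *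
  have hEp := eX_pos ((2 / 3 : ℝ) • (A + (2:ℝ) • B)) ξ t
  have hgp := eX_pos ((2 : ℝ) • B) ξ t
  generalize eX ((2 / 3 : ℝ) • (A + (2:ℝ) • B)) ξ t = E at *
  generalize eX ((2 : ℝ) • B) ξ t = g2 at *
  generalize PP A B ξ t = p at *
  generalize QQ B ξ t = q at *
  generalize Ds ρ (Ds ρ A) ξ t = α1 at *
  generalize Ds ρ (Ds ρ B) ξ t = β1 at *
  generalize Ds ρ A ξ t = α at *
  generalize Ds ρ B ξ t = β at *
  have hα : α = -2 * β := by linarith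
  subst hα
  have her : e ≤ 3 + r * g2 := by
    rcases le_total 0 r with h | h
    · exact (min_le_left _ _).trans (by nlinarith)
    · exact (min_le_right _ _).trans (by nlinarith)
  have hx : α1 + 2 * β1 + 2 * p - 8 * q ≤ -e * q := by
    have h3 : -r - 3 * q ≤ -e * q := by
      have : r = r * g2 * q := by rw [mul_assoc, hrel, mul_one]
      nlinarith
    nlinarith [sq_nonneg β]
  have hy : E * (2 / 3 * (-e * q)) ≤ -(2 / 3 * (2 / 3 * e)) := by
    have h1 : 2 / 3 ≤ E * q := by nlinarith
    nlinarith
  calc _ = E * (2 / 3 * (α1 + 2 * β1 + 2 * p - 8 * q)) := by ring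
    _ ≤ E * (2 / 3 * (-e * q)) := by gcongr
    _ ≤ _ := hy

end geo

section final

lemma bdd_init {T : ℝ} (hT : 0 < T) {u : ℝ → ℝ → ℝ} (h : Sm T u)
    (hp : ∀ ξ t : ℝ, u (ξ + 2 * π) t = u ξ t) : ∃ K, ∀ ξ, u ξ 0 ≤ K := by
  have hc : ContinuousOn (fun z => u z 0) (Icc (0:ℝ) (2 * π)) := fun z _ =>
    (h.hs (ξ := z) le_rfl hT).continuousAt.continuousWithinAt
  obtain ⟨z, hz, hzm⟩ := isCompact_Icc.exists_isMaxOn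
    (⟨0, le_rfl, by positivity⟩ : (Icc (0:ℝ) (2 * π)).Nonempty) hc
  refine ⟨u z 0, fun ξ => ?_⟩
  have hper : Function.Periodic (fun x => u x 0) (2 * π) := fun x => hp x 0
  obtain ⟨y, hy, hyy⟩ := hper.exists_mem_Ico₀ (by positivity) ξ
  have hyy' : u ξ 0 = u y 0 := hyy
  rw [hyy']
  exact hzm ⟨hy.1, hy.2.le⟩

lemma log_facts {T : ℝ} {ρ n c f : ℝ → ℝ → ℝ} (b : Bg T ρ n c) (hf : Sm T f)
    (hpos : ∀ ξ t : ℝ, 0 ≤ t → t < T → 0 < f ξ t) :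
    (∀ ξ t : ℝ, 0 ≤ t → t < T → eX (fun x τ => Real.log (f x τ)) ξ t = f ξ t) ∧
    (∀ ξ t : ℝ, 0 ≤ t → t < T → Ds ρ f ξ t = f ξ t * Ds ρ (fun x τ => Real.log (f x τ)) ξ t) ∧
    (∀ ξ t : ℝ, 0 ≤ t → t < T → Ds ρ (Ds ρ f) ξ t =
      f ξ t * (Ds ρ (Ds ρ (fun x τ => Real.log (f x τ))) ξ t
        + Ds ρ (fun x τ => Real.log (f x τ)) ξ t ^ 2)) ∧
    (∀ ξ t : ℝ, 0 < t → t < T → pdt f ξ t = f ξ t * pdt (fun x τ => Real.log (f x τ)) ξ t) := by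
  have sA := hf.log hpos
  set A : ℝ → ℝ → ℝ := fun x τ => Real.log (f x τ) with hA
  have e1 : ∀ ξ t : ℝ, 0 ≤ t → t < T → eX A ξ t = f ξ t := fun ξ t h0 hT =>
    Real.exp_log (hpos ξ t h0 hT)
  have e2 : ∀ ξ t : ℝ, 0 ≤ t → t < T → Ds ρ f ξ t = f ξ t * Ds ρ A ξ t := by
    intro ξ t h0 hT
    rw [Ds_congr (ψ := eX A) (fun x => (e1 x t h0 hT).symm), Ds_eX sA h0 hT, e1 ξ t h0 hT]
  refine ⟨e1, e2, ?_, ?_⟩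
  · intro ξ t h0 hT
    rw [Ds_congr (ψ := f * Ds ρ A) (fun x => e2 x t h0 hT), Ds_mul hf (sA.Ds b) h0 hT, e2 ξ t h0 hT]
    ring
  · intro ξ t h0 hT
    have := pdt_eX sA (ξ := ξ) h0 hT
    rw [e1 ξ t h0.le hT] at this
    rw [← this]
    apply Filter.EventuallyEq.deriv_eq
    filter_upwards [Ioo_mem_nhds h0 hT] with τ hτ
    exact (e1 ξ τ hτ.1.le hτ.2).symm

lemma PP_eq {A B : ℝ → ℝ → ℝ} (ξ t : ℝ) : PP A B ξ t = eX A ξ t ^ 2 / eX B ξ t ^ 4 := by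
  simp only [PP, eX, Pi.sub_apply, Pi.smul_apply, smul_eq_mul]
  rw [← Real.exp_nat_mul, ← Real.exp_nat_mul, ← Real.exp_sub]; norm_num
lemma QQ_eq {B : ℝ → ℝ → ℝ} (ξ t : ℝ) : QQ B ξ t = 1 / eX B ξ t ^ 2 := by
  simp only [QQ, eX, Pi.smul_apply, smul_eq_mul]
  rw [← Real.exp_nat_mul, one_div, ← Real.exp_neg]; norm_num
lemma e2_eq {A : ℝ → ℝ → ℝ} (ξ t : ℝ) : eX ((2:ℝ) • A) ξ t = eX A ξ t ^ 2 := by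
  simp only [eX, Pi.smul_apply, smul_eq_mul]
  rw [← Real.exp_nat_mul]; norm_num

lemma triv_bg {T : ℝ} {ρ : ℝ → ℝ → ℝ} (h : Sm T ρ) (hp : ∀ ξ t : ℝ, 0 ≤ t → t < T → 0 < ρ ξ t)
    (hper : ∀ ξ t : ℝ, ρ (ξ + 2 * π) t = ρ ξ t) :
    Bg T ρ (fun _ _ => 0) (fun ξ t => pdt ρ ξ t / ρ ξ t) where
  ρsm := h
  ρpos := hp
  ρper := hper
  nsm := contDiffOn_const
  ρt ξ t h0 hT := by
    have := hp ξ t h0.le hT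
    simp only [Ds, pd1, deriv_const]
    field_simp
    ring

lemma mkGeo {T : ℝ} {f g ρ : ℝ → ℝ → ℝ} (sol : WarpedBerger T f g ρ) :
    Geo T ρ (fun x τ => Real.log (f x τ)) (fun x τ => Real.log (g x τ)) := by
  have sf : Sm T f := ContDiffOn.fst sol.smooth
  have sg : Sm T g := ContDiffOn.fst (ContDiffOn.snd sol.smooth)
  have sρ : Sm T ρ := ContDiffOn.snd (ContDiffOn.snd sol.smooth)
  have b := triv_bg sρ sol.ρ_pos sol.ρ_per
  obtain ⟨f1, f2, f3, f4⟩ := log_facts b sf sol.f_pos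
  obtain ⟨g1, g2, g3, g4⟩ := log_facts b sg sol.g_pos
  obtain ⟨-, -, -, r4⟩ := log_facts b sρ sol.ρ_pos
  have sA := sf.log sol.f_pos
  have sB := sg.log sol.g_pos
  set A : ℝ → ℝ → ℝ := fun x τ => Real.log (f x τ) with hA
  set B : ℝ → ℝ → ℝ := fun x τ => Real.log (g x τ) with hB
  have sa : Sm T (Ds ρ A) := sA.Ds b
  have sb : Sm T (Ds ρ B) := sB.Ds b
  refine ⟨⟨sρ, sol.ρ_pos, sol.ρ_per, sa.add (sb.smul 2), ?_⟩, ⟨sA, ?_, ?_⟩, ⟨sB, ?_, ?_⟩⟩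
  · intro ξ t h0 hT
    have hfp := sol.f_pos ξ t h0.le hT
    have hgp := sol.g_pos ξ t h0.le hT
    rw [r4 ξ t h0 hT, sol.eq_ρ ξ t h0 hT, f3 ξ t h0.le hT, g3 ξ t h0.le hT, nn,
      Ds_add sa (sb.smul 2) h0.le hT, Ds_smul 2 sb h0.le hT]
    simp only [cc, Pi.add_apply, Pi.mul_apply, Pi.smul_apply, smul_eq_mul]
    field_simp
    ring
  · intro ξ t; simp only [hA, sol.f_per]
  · intro ξ t h0 hT
    have hfp := sol.f_pos ξ t h0.le hT
    have hgp := sol.g_pos ξ t h0.le hT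
    have := sol.eq_f ξ t h0 hT
    rw [f4 ξ t h0 hT, f3 ξ t h0.le hT, g2 ξ t h0.le hT, f2 ξ t h0.le hT] at this
    simp only [nn, Pi.add_apply, Pi.smul_apply, smul_eq_mul]
    rw [PP_eq, f1 ξ t h0.le hT, g1 ξ t h0.le hT]
    apply mul_left_cancel₀ hfp.ne'
    rw [this]
    field_simp
    ring
  · intro ξ t; simp only [hB, sol.g_per]
  · intro ξ t h0 hT
    have hfp := sol.f_pos ξ t h0.le hT
    have hgp := sol.g_pos ξ t h0.le hT
    have := sol.eq_g ξ t h0 hT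
    rw [g4 ξ t h0 hT, g3 ξ t h0.le hT, g2 ξ t h0.le hT, f2 ξ t h0.le hT] at this
    simp only [nn, Pi.add_apply, Pi.sub_apply, Pi.smul_apply, smul_eq_mul]
    rw [PP_eq, QQ_eq, f1 ξ t h0.le hT, g1 ξ t h0.le hT]
    apply mul_left_cancel₀ hgp.ne'
    rw [this]
    field_simp
    ring

end final
/-- Under Assumption B there is a uniform constant `C` such that
`|κ₁₂ − κ₂₃| ≤ C/M`, and consequently `(T−t)|κ₁₂ − κ₂₃| ≤ C√(T−t)`. -/
theorem vertical_curvature_pinching (T : ℝ) (f g ρ : ℝ → ℝ → ℝ)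
    (sol : AssumptionB T f g ρ) :
    ∃ C : ℝ, ∀ ξ t : ℝ, 0 ≤ t → t < T →
      |k12 ρ f g ξ t - k23 ρ f g ξ t| ≤ C / M f g ξ t ∧
      (T - t) * |k12 ρ f g ξ t - k23 ρ f g ξ t| ≤ C * Real.sqrt (T - t) := by
  have wb : WarpedBerger T f g ρ := sol.toAssumptionA.toWarpedBerger
  have G := mkGeo wb
  have sf : Sm T f := ContDiffOn.fst wb.smooth
  have sg : Sm T g := ContDiffOn.fst (ContDiffOn.snd wb.smooth)
  obtain ⟨f1, f2, f3, -⟩ := log_facts G.bg sf wb.f_pos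
  obtain ⟨g1, g2, g3, -⟩ := log_facts G.bg sg wb.g_pos
  set A : ℝ → ℝ → ℝ := fun x τ => Real.log (f x τ) with hA
  set B : ℝ → ℝ → ℝ := fun x τ => Real.log (g x τ) with hB
  have T0 := wb.T_pos
  -- order
  have ho := G.ord (fun ξ => Real.log_le_log (wb.f_pos ξ 0 le_rfl T0) (sol.init_order ξ))
  have hfg : ∀ ξ t, 0 ≤ t → t < T → f ξ t ≤ g ξ t := by
    intro ξ t h0 hT
    rw [← f1 ξ t h0 hT, ← g1 ξ t h0 hT]
    exact Real.exp_le_exp.2 (ho ξ t h0 hT)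
  -- pinching
  obtain ⟨ε, he0, he1, he2, he3⟩ := sol.init_pinched
  have hε : 2 / 3 ≤ 1 - ε := by
    by_contra hcon
    push Not at hcon
    have h4 : (1 - ε) ^ 4 ≤ (2 / 3 : ℝ) ^ 4 := by gcongr <;> linarith
    have h5 : (1 - ε) ^ 5 ≤ (2 / 3 : ℝ) ^ 5 := by gcongr <;> linarith
    norm_num at h4 h5
    linarith
  have hpin := G.pinch ho (Real.log (3 / 2)) (by
    intro ξ
    have hfp := wb.f_pos ξ 0 le_rfl T0
    have hgp := wb.g_pos ξ 0 le_rfl T0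
    have h1 : g ξ 0 ≤ 3 / 2 * f ξ 0 := by nlinarith [he3 ξ]
    have := Real.log_le_log hgp h1
    rw [Real.log_mul (by norm_num) hfp.ne'] at this
    simp only [hA, hB]
    linarith)
  have hl : ∀ ξ t, 0 ≤ t → t < T → 2 / 3 * eX B ξ t ≤ eX A ξ t := by
    intro ξ t h0 hT
    have h1 : eX B ξ t ≤ 3 / 2 * eX A ξ t := by
      calc eX B ξ t ≤ Real.exp (Real.log (3 / 2) + A ξ t) :=
            Real.exp_le_exp.2 (by linarith [hpin ξ t h0 hT])
        _ = _ := by rw [Real.exp_add, Real.exp_log (by norm_num)]; rfl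
    linarith
  -- gradient of f
  have hfs := G.fs ho (by
    intro ξ
    have h1 := sol.init_fs ξ
    simp only [Pi.mul_apply]
    rw [e2_eq, f1 ξ 0 le_rfl T0]
    have h2 : Ds ρ A ξ 0 * Ds ρ A ξ 0 * f ξ 0 ^ 2 = Ds ρ f ξ 0 ^ 2 := by
      rw [f2 ξ 0 le_rfl T0]; ring
    rw [h2, ← sq_abs]
    nlinarith [abs_nonneg (Ds ρ f ξ 0)])
  -- gradient of g
  have Hg := (G.hb.mul G.bg G.hb).mul G.bg ((G.hB.smul G.bg 2).eX G.bg)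
  obtain ⟨Kg0, hKg0⟩ := bdd_init T0 Hg.sm Hg.per
  obtain ⟨Kg, hKg5, hKgle⟩ : ∃ Kg : ℝ, 5 ≤ Kg ∧ Kg0 ≤ Kg := ⟨max 5 Kg0, le_max_left _ _, le_max_right _ _⟩
  have hgs := G.gs ho Kg hKg5 (fun ξ => (hKg0 ξ).trans hKgle)
  -- W
  have HW := ((G.hB.sub G.bg (G.hA.smul G.bg 2)).eX G.bg).sub G.bg
    ((G.hA.smul G.bg (-1)).eX G.bg)
  obtain ⟨Kw0, hKw0⟩ := bdd_init T0 HW.sm HW.per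
  obtain ⟨K, hK0, hKle⟩ : ∃ K : ℝ, 0 ≤ K ∧ Kw0 ≤ K := ⟨max 0 Kw0, le_max_left _ _, le_max_right _ _⟩
  have hW := G.WW ho hl hfs K (fun ξ => (hKw0 ξ).trans hKle)
  -- pointwise consequences
  have hyx : ∀ ξ t, 0 ≤ t → t < T → eX B ξ t - eX A ξ t ≤ K * eX A ξ t ^ 2 := by
    intro ξ t h0 hT
    have h1 := hW ξ t h0 hT
    have hx := eX_pos A ξ t
    have r1 : eX (B - (2:ℝ) • A) ξ t = eX B ξ t / eX A ξ t ^ 2 := by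
      simp only [eX, Pi.sub_apply, Pi.smul_apply, smul_eq_mul]
      rw [← Real.exp_nat_mul, ← Real.exp_sub]; norm_num
    have r2 : eX ((-1:ℝ) • A) ξ t = 1 / eX A ξ t := by
      simp only [eX, Pi.smul_apply, smul_eq_mul]
      rw [neg_one_mul, Real.exp_neg, one_div]
    simp only [Pi.sub_apply] at h1
    rw [r1, r2] at h1
    have : eX B ξ t / eX A ξ t ^ 2 - 1 / eX A ξ t = (eX B ξ t - eX A ξ t) / eX A ξ t ^ 2 := by
      field_simp
    rw [this, div_le_iff₀ (by positivity)] at h1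
    exact h1
  have hQP : ∀ ξ t, 0 ≤ t → t < T → 0 ≤ QQ B ξ t - PP A B ξ t ∧
      (QQ B ξ t - PP A B ξ t) * eX B ξ t ≤ 2 * K := by
    intro ξ t h0 hT
    refine ⟨by linarith [PQ_le (ho ξ t h0 hT)], ?_⟩
    rw [PP_eq, QQ_eq]
    have hx := eX_pos A ξ t
    have hy := eX_pos B ξ t
    have hxy : eX A ξ t ≤ eX B ξ t := Real.exp_le_exp.2 (ho ξ t h0 hT)
    have h1 := hyx ξ t h0 hT
    generalize eX A ξ t = x at *
    generalize eX B ξ t = y at *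
    have e : (1 / y ^ 2 - x ^ 2 / y ^ 4) * y = (y - x) * (y + x) / y ^ 3 := by
      field_simp
      ring
    rw [e, div_le_iff₀ (by positivity)]
    calc (y - x) * (y + x) ≤ (K * x ^ 2) * (2 * y) := by
          apply mul_le_mul h1 (by linarith) (by linarith) (by positivity)
      _ ≤ (K * y ^ 2) * (2 * y) := by gcongr
      _ = _ := by ring
  have hby : ∀ ξ t, 0 ≤ t → t < T → |Ds ρ B ξ t| * eX B ξ t ≤ Kg := by
    intro ξ t h0 hT
    have h1 := hgs ξ t h0 hT
    simp only [Pi.mul_apply] at h1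
    rw [e2_eq] at h1
    have hy := eX_pos B ξ t
    apply le_of_pow_le_pow_left₀ (n := 2) (by norm_num) (by linarith : (0:ℝ) ≤ Kg)
    rw [mul_pow, sq_abs]
    nlinarith
  -- difference of log-gradients
  have Hd0 := G.hb.sub G.bg G.ha
  have Hd := Hd0.mul G.bg Hd0
  obtain ⟨Kd0, hKd0⟩ := bdd_init T0 Hd.sm Hd.per
  obtain ⟨Kd, hKd1, hKd2, hKdle⟩ : ∃ Kd : ℝ, 1 ≤ Kd ∧ (9 / 4 * (2 * K * Kg)) ^ 2 ≤ Kd ∧ Kd0 ≤ Kd :=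
    ⟨max 1 (max ((9 / 4 * (2 * K * Kg)) ^ 2) Kd0), le_max_left _ _,
      (le_max_left _ _).trans (le_max_right _ _), (le_max_right _ _).trans (le_max_right _ _)⟩
  have hdd := G.dd (2 * K * Kg) Kd (by positivity) hKd2 (by
      intro ξ t h0 hT
      rw [PP_eq, QQ_eq]
      have hx := eX_pos A ξ t
      have hy := eX_pos B ξ t
      have h1 := hl ξ t h0 hT
      rw [mul_one_div, div_le_div_iff₀ (by positivity) (by positivity)]
      have h2 : 4 / 9 * eX B ξ t ^ 2 ≤ eX A ξ t ^ 2 := by nlinarith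
      calc 4 / 9 * eX B ξ t ^ 4 = (4 / 9 * eX B ξ t ^ 2) * eX B ξ t ^ 2 := by ring
        _ ≤ _ := by gcongr) (by
      intro ξ t h0 hT
      obtain ⟨q1, q2⟩ := hQP ξ t h0 hT
      have h1 := hby ξ t h0 hT
      have hy := eX_pos B ξ t
      rw [abs_mul, abs_of_nonneg q1]
      nth_rewrite 2 [QQ_eq]
      rw [mul_one_div, le_div_iff₀ (by positivity)]
      calc |Ds ρ B ξ t| * (QQ B ξ t - PP A B ξ t) * eX B ξ t ^ 2
          = ((QQ B ξ t - PP A B ξ t) * eX B ξ t) * (|Ds ρ B ξ t| * eX B ξ t) := by ring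
        _ ≤ (2 * K) * Kg := by
          apply mul_le_mul q2 h1 (by positivity) (by positivity))
    (fun ξ => (hKd0 ξ).trans hKdle)
  have hd : ∀ ξ t, 0 ≤ t → t < T → |Ds ρ B ξ t - Ds ρ A ξ t| ≤ Kd := by
    intro ξ t h0 hT
    have h1 := hdd ξ t h0 hT
    simp only [Pi.mul_apply, Pi.sub_apply] at h1
    apply le_of_pow_le_pow_left₀ (n := 2) (by norm_num) (by linarith : (0:ℝ) ≤ Kd)
    rw [sq_abs]
    nlinarith
  -- first bound
  set C0 := 8 * K + Kg * Kd with hC0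
  have hC0p : 0 ≤ C0 := by positivity
  have hM : ∀ ξ t, 0 ≤ t → t < T → M f g ξ t = f ξ t := fun ξ t h0 hT => min_eq_left (hfg ξ t h0 hT)
  have first : ∀ ξ t, 0 ≤ t → t < T → |k12 ρ f g ξ t - k23 ρ f g ξ t| ≤ C0 / g ξ t := by
    intro ξ t h0 hT
    have hfp := wb.f_pos ξ t h0 hT
    have hgp := wb.g_pos ξ t h0 hT
    have e : k12 ρ f g ξ t - k23 ρ f g ξ t = -4 * (QQ B ξ t - PP A B ξ t)
        + Ds ρ B ξ t * (Ds ρ B ξ t - Ds ρ A ξ t) := by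
      unfold k12 k23
      rw [PP_eq, QQ_eq, f1 ξ t h0 hT, g1 ξ t h0 hT, f2 ξ t h0 hT, g2 ξ t h0 hT]
      field_simp
      ring
    obtain ⟨q1, q2⟩ := hQP ξ t h0 hT
    have h1 := hby ξ t h0 hT
    rw [g1 ξ t h0 hT] at q2 h1
    have h2 := hd ξ t h0 hT
    rw [le_div_iff₀ hgp, e]
    calc |-4 * (QQ B ξ t - PP A B ξ t) + Ds ρ B ξ t * (Ds ρ B ξ t - Ds ρ A ξ t)| * g ξ t
        ≤ (|-4 * (QQ B ξ t - PP A B ξ t)| + |Ds ρ B ξ t * (Ds ρ B ξ t - Ds ρ A ξ t)|) * g ξ t := by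
          gcongr; exact abs_add_le _ _
      _ = 4 * ((QQ B ξ t - PP A B ξ t) * g ξ t)
          + (|Ds ρ B ξ t| * g ξ t) * |Ds ρ B ξ t - Ds ρ A ξ t| := by
          rw [abs_mul, abs_mul, abs_of_nonneg q1]; norm_num; ring
      _ ≤ 4 * (2 * K) + Kg * Kd := by gcongr
      _ = C0 := by rw [hC0]; ring
  -- scalar curvature
  have hmR : ∀ ξ t, 0 ≤ t → t < T → mR ρ A B ξ t = - scalR ρ f g ξ t := by
    intro ξ t h0 hT
    have hfp := wb.f_pos ξ t h0 hT
    have hgp := wb.g_pos ξ t h0 hT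
    unfold scalR k01 k02 k12 k23
    simp only [mR, Pi.add_apply, Pi.sub_apply, Pi.mul_apply, Pi.smul_apply, smul_eq_mul]
    rw [PP_eq, QQ_eq, f1 ξ t h0 hT, g1 ξ t h0 hT, f3 ξ t h0 hT, g3 ξ t h0 hT, f2 ξ t h0 hT,
      g2 ξ t h0 hT]
    field_simp
    ring
  have smR : Sm T (mR ρ A B) :=
    ((((((G.sa.Ds G.bg).add ((G.sb.Ds G.bg).smul 2)).add (G.sa.mul G.sa)).add
      ((G.sb.mul G.sb).smul 3)).add ((G.sa.mul G.sb).smul 2)).sub (G.sQ.smul 4)).add G.sP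
  obtain ⟨Kr, hKr⟩ := bdd_init T0 smR (by
    intro ξ t
    have p1 := G.hA.per
    have p2 := G.hB.per
    simp only [mR, PP, QQ, eX, Pi.add_apply, Pi.sub_apply, Pi.mul_apply, Pi.smul_apply,
      Ds_per G.bg (Ds_per G.bg p1), Ds_per G.bg (Ds_per G.bg p2), Ds_per G.bg p1, Ds_per G.bg p2,
      p1, p2])
  have hR := G.Rmin (-(⨅ ξ : ℝ, scalR ρ f g ξ 0)) (by
    intro ξ
    rw [hmR ξ 0 le_rfl T0]
    have hb : BddBelow (Set.range fun ξ : ℝ => scalR ρ f g ξ 0) := by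
      refine ⟨-Kr, ?_⟩
      rintro _ ⟨x, rfl⟩
      have := hKr x
      rw [hmR x 0 le_rfl T0] at this
      simp only
      linarith
    have := ciInf_le hb ξ
    linarith)
  have HG := (G.hB.smul G.bg 2).eX G.bg
  obtain ⟨K2, hK2⟩ := bdd_init T0 HG.sm HG.per
  have hgm := G.gmax ho (⨆ ξ : ℝ, (g ξ 0) ^ 2) (by
    intro ξ
    rw [e2_eq, g1 ξ 0 le_rfl T0]
    have hb : BddAbove (Set.range fun ξ : ℝ => (g ξ 0) ^ 2) := by
      refine ⟨K2, ?_⟩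
      rintro _ ⟨x, rfl⟩
      have := hK2 x
      rw [e2_eq, g1 x 0 le_rfl T0] at this
      exact this
    exact le_ciSup hb ξ)
  obtain ⟨κ, hκ, hrate⟩ := G.rate ho _ _ hR hgm sol.init_scalar hl
  have hg2 : ∀ ξ t, 0 < t → t < T → κ * (T - t) ≤ g ξ t ^ 2 := by
    intro ξ t h0 hT
    refine (hrate ξ t h0 hT).trans ?_
    rw [← g1 ξ t h0.le hT, ← e2_eq]
    apply Real.exp_le_exp.2
    simp only [Pi.add_apply, Pi.smul_apply, smul_eq_mul]
    linarith [ho ξ t h0.le hT]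
  have hg2' : ∀ ξ t, 0 ≤ t → t < T → κ * (T - t) ≤ g ξ t ^ 2 := by
    intro ξ t h0 hT
    rcases h0.eq_or_lt with h | h
    · subst h
      have hc : ContinuousWithinAt (fun τ => g ξ τ ^ 2) (Ico 0 T) 0 := by
        have h1 : ContinuousOn (fun τ => g ξ τ) (Ico 0 T) :=
          sg.cont.comp (f := fun τ : ℝ => (ξ, τ)) (by fun_prop) (fun τ hτ => ⟨mem_univ _, hτ⟩)
        exact (h1.pow 2) 0 ⟨le_rfl, hT⟩
      have hc1 : Tendsto (fun τ => g ξ τ ^ 2) (𝓝[>] 0) (𝓝 (g ξ 0 ^ 2)) :=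
        hc.tendsto.mono_left (nhdsWithin_le_of_mem (mem_of_superset (Ioo_mem_nhdsGT hT)
          (fun τ hτ => ⟨hτ.1.le, hτ.2⟩)))
      have hc2 : Tendsto (fun τ : ℝ => κ * (T - τ)) (𝓝[>] 0) (𝓝 (κ * (T - 0))) := by
        have : ContinuousAt (fun τ : ℝ => κ * (T - τ)) 0 := by fun_prop
        exact this.tendsto.mono_left nhdsWithin_le_nhds
      refine le_of_tendsto_of_tendsto hc2 hc1 ?_
      filter_upwards [Ioo_mem_nhdsGT hT] with τ hτ
      exact hg2 ξ τ hτ.1 hτ.2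
    · exact hg2 ξ t h hT
  refine ⟨C0 + C0 / √κ, ?_⟩
  intro ξ t h0 hT
  have hfp := wb.f_pos ξ t h0 hT
  have hgp := wb.g_pos ξ t h0 hT
  have h1 := first ξ t h0 hT
  have hsκ : 0 < √κ := Real.sqrt_pos.2 hκ
  have hst : 0 < √(T - t) := Real.sqrt_pos.2 (by linarith)
  constructor
  · rw [hM ξ t h0 hT]
    calc _ ≤ C0 / g ξ t := h1
      _ ≤ C0 / f ξ t := by gcongr; exact hfg ξ t h0 hT
      _ ≤ (C0 + C0 / √κ) / f ξ t := by gcongr; linarith [div_nonneg hC0p hsκ.le]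
  · have h2 : √κ * √(T - t) ≤ g ξ t := by
      rw [← Real.sqrt_mul hκ.le]
      exact Real.sqrt_le_iff.2 ⟨hgp.le, hg2' ξ t h0 hT⟩
    have h3 : (T - t) = √(T - t) * √(T - t) := (Real.mul_self_sqrt (by linarith)).symm
    calc (T - t) * |k12 ρ f g ξ t - k23 ρ f g ξ t| ≤ (T - t) * (C0 / g ξ t) := by
          gcongr
      _ ≤ (T - t) * (C0 / (√κ * √(T - t))) := by
          gcongr
      _ = C0 / √κ * √(T - t) := by
          nth_rewrite 1 [h3]
          field_simp
      _ ≤ (C0 + C0 / √κ) * √(T - t) := by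
          gcongr; linarith
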